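/- arXiv:0712.2946 — 2 statements merged into one kernel-verified Lean document; each statement's English description precedes it below -/
import Mathlib

section
/- Let T be an ℝ-tree with a very small isometric action of the free group F_N (N ≥ 2) with dense orbits, and let 𝒬 : ∂F_N → T̂ be a map with the property that for any sequence uₙ ∈ F_N converging to X ∈ ∂F_N and any point P ∈ T, if the points uₙP converge in the metric of T̄ to a point Q₀, then 𝒬(X) = Q₀. Let K be a compact (in the metric topology) subtree of T̄, let Q ∈ K, and let wₙ be a sequence of elements of F_N converging in F_N ∪ ∂F_N to some X ∈ ∂F_N such that wₙ⁻¹Q ∈ K for all n. Then 𝒬(X) = Q. -/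
/-!
Common formalization framework for "ℝ-trees, dual laminations, and compact systems
of partial isometries" (Coulbois–Hilion–Lustig).
-/

open Set Filter Topology Pointwise

noncomputable section

namespace CHL

/-! ### ℝ-trees -/

/-- The metric betweenness segment `[x,y]`.  In an ℝ-tree this is exactly the unique
topological arc joining `x` to `y`, which is a geodesic segment. -/
def seg {T : Type*} [MetricSpace T] (x y : T) : Set T :=
  {z | dist x z + dist z y = dist x y}

/-- An ℝ-tree: a geodesic metric space which is `0`-hyperbolic (four point condition).
Equivalently, any two points are joined by a unique topological arc, and this arc is a
geodesic segment. -/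
class IsRTree (T : Type*) [MetricSpace T] : Prop where
  geodesic : ∀ x y : T, ∃ f : ℝ → T, f 0 = x ∧ f (dist x y) = y ∧
      ∀ s ∈ Set.Icc (0 : ℝ) (dist x y), ∀ t ∈ Set.Icc (0 : ℝ) (dist x y),
        dist (f s) (f t) = |s - t|
  four_point : ∀ x y z w : T,
      dist x y + dist z w ≤ max (dist x z + dist y w) (dist x w + dist y z)

/-- A subtree of an ℝ-tree: a convex subset. -/
def IsSubtree {T : Type*} [MetricSpace T] (A : Set T) : Prop :=
  ∀ x ∈ A, ∀ y ∈ A, seg x y ⊆ A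

/-- A non-empty closed subtree. -/
def IsClosedSubtree {T : Type*} [MetricSpace T] (A : Set T) : Prop :=
  A.Nonempty ∧ IsClosed A ∧ IsSubtree A

/-- The convex hull of a subset of an ℝ-tree: the smallest subtree containing it. -/
def subtreeHull {T : Type*} [MetricSpace T] (S : Set T) : Set T :=
  ⋂₀ {A : Set T | S ⊆ A ∧ IsSubtree A}

/-- A finite tree: the convex hull of finitely many points. -/
def IsFiniteSubtree {T : Type*} [MetricSpace T] (A : Set T) : Prop :=
  ∃ F : Finset T, A = subtreeHull (F : Set T)

/-- `[x,x']` is the segment joining `A` to `B`: its endpoints are the only points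
in `A` resp. `B` that it meets. -/
def IsBridge {T : Type*} [MetricSpace T] (A B : Set T) (x x' : T) : Prop :=
  x ∈ A ∧ x' ∈ B ∧ seg x x' ∩ A = {x} ∧ seg x x' ∩ B = {x'}

/-- A morphism of ℝ-trees: a continuous map such that every segment is mapped locally
injectively except at finitely many points. -/
def IsTreeMorphism {T T' : Type*} [MetricSpace T] [MetricSpace T'] (f : T → T') : Prop :=
  Continuous f ∧ ∀ x y : T, ∃ F : Finset T, ∀ p ∈ seg x y, p ∉ (F : Set T) →
    ∃ U ∈ nhdsWithin p (seg x y), Set.InjOn f U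

/-- The translation length `‖g‖_T = inf_{x ∈ T} d(x, gx)`. -/
def translationLength (G : Type*) [Group G] (T : Type*) [MetricSpace T] [MulAction G T]
    (g : G) : ℝ :=
  ⨅ x : T, dist x (g • x)

/-- The translation length of `g` on an invariant subtree `A`. -/
def translationLengthOn {G : Type*} [Group G] {T : Type*} [MetricSpace T] [MulAction G T]
    (A : Set T) (g : G) : ℝ :=
  ⨅ x : A, dist (x : T) (g • (x : T))

/-- The minimal `G`-invariant subtree. -/
def minSubtree (G : Type*) [Group G] (T : Type*) [MetricSpace T] [MulAction G T] : Set T :=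
  ⋂₀ {A : Set T | A.Nonempty ∧ IsSubtree A ∧ ∀ g : G, ∀ x ∈ A, g • x ∈ A}

/-! ### Free groups, reduced words and the boundary `∂F(𝒜)` -/

/-- Two letters of `𝒜^{±1}` are inverse to each other. -/
def LettersInv {ι : Type*} (a b : ι × Bool) : Prop := a.1 = b.1 ∧ a.2 = !b.2

/-- The prefix of length `n` of (the reduced word of) `w`. -/
def gprefix {ι : Type*} [DecidableEq ι] (w : FreeGroup ι) (n : ℕ) : FreeGroup ι :=
  FreeGroup.mk (w.toWord.take n)

/-- An infinite reduced word in the letters `𝒜^{±1}`: a point of the Gromov boundary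
`∂F(𝒜)` of the free group `F(𝒜)`. -/
structure InfWord (ι : Type*) where
  letter : ℕ → ι × Bool
  reduced : ∀ n, ¬ LettersInv (letter n) (letter (n + 1))

/-- The prefix `X_n` of length `n` of an infinite reduced word `X`. -/
def InfWord.prefixN {ι : Type*} (X : InfWord ι) (n : ℕ) : FreeGroup ι :=
  FreeGroup.mk (List.ofFn fun i : Fin n => X.letter i)

/-- The infinite word `X_k⁻¹ X` obtained by deleting the first `k` letters. -/
def InfWord.shift {ι : Type*} (X : InfWord ι) (k : ℕ) : InfWord ι :=
  ⟨fun n => X.letter (k + n), fun n => X.reduced (k + n)⟩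

/-- A sequence `wₙ ∈ F(𝒜)` converges in `F(𝒜) ∪ ∂F(𝒜)` to the infinite word `X` iff
the length of the maximal common prefix of `wₙ` and `X` tends to infinity. -/
def TendstoBoundary {ι : Type*} [DecidableEq ι] (w : ℕ → FreeGroup ι) (X : InfWord ι) : Prop :=
  ∀ k : ℕ, ∀ᶠ n in atTop, (w n).toWord.take k = List.ofFn fun i : Fin k => X.letter i

/-- `Y = w · X` for the left action of `F(𝒜)` on its boundary `∂F(𝒜)`. -/
def SmulBoundary {ι : Type*} [DecidableEq ι] (w : FreeGroup ι) (X Y : InfWord ι) : Prop :=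
  TendstoBoundary (fun n => w * X.prefixN n) Y

/-- The (Cantor set) topology on `∂F(𝒜)`, induced by the product topology on sequences
of letters. -/
instance {ι : Type*} : TopologicalSpace (InfWord ι) :=
  TopologicalSpace.induced (fun X => X.letter)
    (@Pi.topologicalSpace ℕ (fun _ => ι × Bool) fun _ => ⊥)

/-- A non-trivial element of `F(𝒜)` is cyclically reduced if the first letter of its reduced
word is not the inverse of its last letter. -/
def IsCyclicallyReduced {ι : Type*} [DecidableEq ι] (w : FreeGroup ι) : Prop :=
  w ≠ 1 ∧ ∀ a ∈ w.toWord.head?, ∀ b ∈ w.toWord.getLast?, ¬ LettersInv a b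

/-- The dual laminary language `ℒ_𝒜(T)` of an isometric action of `F(𝒜)` on `T`. -/
def dualLanguage (ι : Type*) [DecidableEq ι] (T : Type*) [MetricSpace T]
    [MulAction (FreeGroup ι) T] : Set (FreeGroup ι) :=
  {v | ∀ ε > (0 : ℝ), ∃ u w : FreeGroup ι,
      (u * v * w).toWord = u.toWord ++ v.toWord ++ w.toWord ∧
      IsCyclicallyReduced (u * v * w) ∧
      translationLength (FreeGroup ι) T (u * v * w) < ε}

/-- The dual laminary language `ℒ_𝒜(T)`, for the action restricted to an invariant
subtree `A`. -/
def dualLanguageOn (ι : Type*) [DecidableEq ι] {T : Type*} [MetricSpace T]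
    [MulAction (FreeGroup ι) T] (A : Set T) : Set (FreeGroup ι) :=
  {v | ∀ ε > (0 : ℝ), ∃ u w : FreeGroup ι,
      (u * v * w).toWord = u.toWord ++ v.toWord ++ w.toWord ∧
      IsCyclicallyReduced (u * v * w) ∧
      translationLengthOn A (u * v * w) < ε}

/-! ### Systems of isometries on a compact ℝ-tree -/

/-- A system of isometries `𝒦 = (K, 𝒜)`: a family, indexed by `ι`, of non-empty partial
isometries of the compact ℝ-tree `K`, i.e. isometries between non-empty closed subtrees. -/
structure SystemOfIsometries (K : Type*) [MetricSpace K] (ι : Type*) where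
  pe : ι → PartialEquiv K K
  isom : ∀ i, ∀ x ∈ (pe i).source, ∀ y ∈ (pe i).source, dist (pe i x) (pe i y) = dist x y
  source_subtree : ∀ i, IsClosedSubtree (pe i).source
  target_subtree : ∀ i, IsClosedSubtree (pe i).target

namespace SystemOfIsometries

variable {K : Type*} [MetricSpace K] {ι : Type*} (S : SystemOfIsometries K ι)

/-- The partial isometry associated to a letter in `𝒜^{±1}`. -/
def letterPE : ι × Bool → PartialEquiv K K
  | (i, true) => S.pe i
  | (i, false) => (S.pe i).symm

/-- The partial isometry `z₁ ∘ z₂ ∘ ⋯ ∘ zₙ` (acting on the right: first `z₁`, then `z₂`, …)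
associated to the reduced word `w = z₁ ⋯ zₙ ∈ F(𝒜)`. -/
def wordPE [DecidableEq ι] (w : FreeGroup ι) : PartialEquiv K K :=
  (w.toWord.map S.letterPE).foldl PartialEquiv.trans (PartialEquiv.refl K)

/-- The domain `dom (w)` of the partial isometry associated to `w`. -/
def dom [DecidableEq ι] (w : FreeGroup ι) : Set K := (S.wordPE w).source

/-- A word is admissible if it is non-empty as a partial isometry of `K`. -/
def Admissible [DecidableEq ι] (w : FreeGroup ι) : Prop := (S.dom w).Nonempty

/-- An infinite word is admissible if all its prefixes are admissible. -/
def AdmissibleInf [DecidableEq ι] (X : InfWord ι) : Prop := ∀ n, S.Admissible (X.prefixN n)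

/-- The domain of an infinite word: the intersection of the domains of its prefixes. -/
def domInf [DecidableEq ι] (X : InfWord ι) : Set K := ⋂ n, S.dom (X.prefixN n)

/-- An infinite word `X` is eventually admissible if some suffix `X_k⁻¹ X` is admissible. -/
def EventuallyAdmissible [DecidableEq ι] (X : InfWord ι) : Prop :=
  ∃ k, S.AdmissibleInf (X.shift k)

/-- The system `𝒦` has independent generators if the (non-empty) domain of every
admissible infinite word consists of exactly one point. -/
def IndependentGenerators [DecidableEq ι] : Prop :=
  ∀ X : InfWord ι, S.AdmissibleInf X → ∃ x : K, S.domInf X = {x}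

/-- The admissible laminary language `ℒ_adm(𝒦)`: the largest laminary language consisting of
admissible words; `w ∈ ℒ_adm(𝒦)` iff for every `k` the word `w` is obtained from some
admissible word `v` by deleting its prefix and its suffix of length `k`. -/
def admLanguage [DecidableEq ι] : Set (FreeGroup ι) :=
  {w | ∀ k : ℕ, ∃ v : FreeGroup ι, S.Admissible v ∧
      ∃ p s : List (ι × Bool), p.length = k ∧ s.length = k ∧
        v.toWord = p ++ w.toWord ++ s}

end SystemOfIsometries

/-- The ℝ-tree `T_𝒦` associated to a system of isometries `𝒦 = (K, 𝒜)`, presented through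
its characteristic properties (Theorem 3.2 of the paper, by which it is unique):
`T_𝒦` contains `K` as an isometrically embedded subtree (1); the left action of `F(𝒜)`
is compatible with the partial isometries (2); every orbit meets `K`, and indeed every
segment is covered by finitely many translates of `K` (3); and `T_𝒦` is universal among
trees satisfying (1) and (2), via unique equivariant morphisms (4). -/
structure AssocTree {K : Type} [MetricSpace K] {ι : Type} [DecidableEq ι]
    (S : SystemOfIsometries K ι) where
  carrier : Type
  [ms : MetricSpace carrier]
  tree : IsRTree carrier
  [act : MulAction (FreeGroup ι) carrier]
  act_isom : ∀ g : FreeGroup ι, Isometry fun x : carrier => g • x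
  emb : K → carrier
  emb_isom : Isometry emb
  emb_subtree : IsSubtree (Set.range emb)
  compat : ∀ i : ι, ∀ x ∈ (S.pe i).source, (FreeGroup.of i)⁻¹ • emb x = emb (S.pe i x)
  orbit_meets : ∀ p : carrier, ∃ (w : FreeGroup ι) (x : K), p = w • emb x
  seg_cover : ∀ p q : carrier, ∃ F : Finset (FreeGroup ι),
      seg p q ⊆ ⋃ w ∈ F, w • Set.range emb
  universal : ∀ (T' : Type) [MetricSpace T'] [MulAction (FreeGroup ι) T'],
      (∀ g : FreeGroup ι, Isometry fun x : T' => g • x) →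
      ∀ e' : K → T', Isometry e' →
      (∀ i : ι, ∀ x ∈ (S.pe i).source, (FreeGroup.of i)⁻¹ • e' x = e' (S.pe i x)) →
      ∃! f : carrier → T', IsTreeMorphism f ∧
        (∀ (g : FreeGroup ι) (p : carrier), f (g • p) = g • f p) ∧
        ∀ x : K, f (emb x) = e' x

attribute [instance] AssocTree.ms AssocTree.act

/-! ### Very small minimal actions with dense orbits, and their metric completion -/

/-- An ℝ-tree `T` (here: the subtree `Tsub` of the complete ℝ-tree `Tb`, whose metric
completion `T̄` is `Tb`) with a very small, minimal, isometric action of the free group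
`F(𝒜)` with dense orbits.  (For actions with dense orbits, "very small" is equivalent to
"trivial arc stabilizers".) -/
structure TreeSetup (ι : Type) where
  Tb : Type
  [ms : MetricSpace Tb]
  complete : CompleteSpace Tb
  tree : IsRTree Tb
  [act : MulAction (FreeGroup ι) Tb]
  act_isom : ∀ g : FreeGroup ι, Isometry fun x : Tb => g • x
  Tsub : Set Tb
  nonempty : Tsub.Nonempty
  dense : Dense Tsub
  sub_subtree : IsSubtree Tsub
  invariant : ∀ g : FreeGroup ι, ∀ x ∈ Tsub, g • x ∈ Tsub
  minimal : ∀ A : Set Tb, A ⊆ Tsub → A.Nonempty → IsSubtree A →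
      (∀ g : FreeGroup ι, ∀ x ∈ A, g • x ∈ A) → A = Tsub
  dense_orbits : ∀ x ∈ Tsub, Tsub ⊆ closure (Set.range fun g : FreeGroup ι => g • x)
  arc_stab : ∀ g : FreeGroup ι, ∀ x ∈ Tsub, ∀ y ∈ Tsub, x ≠ y →
      (fun p => g • p) '' seg x y = seg x y → g = 1

attribute [instance] TreeSetup.ms TreeSetup.act

/-- `𝒬(X) = Q` (for `Q ∈ T̄`), where `𝒬 : ∂F_N → T̂` is the map of Levitt–Lustig:
it is characterized by the property that whenever a sequence `uₙ ∈ F_N` converges to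
`X ∈ ∂F_N` and `uₙ P` converges metrically in `T̄` to a point `Q`, then `𝒬(X) = Q`. -/
def QRel {ι : Type} [DecidableEq ι] (St : TreeSetup ι) (X : InfWord ι) (Q : St.Tb) : Prop :=
  ∃ P ∈ St.Tsub, ∃ u : ℕ → FreeGroup ι, TendstoBoundary u X ∧
    Tendsto (fun n => u n • P) atTop (𝓝 Q)

/-- The limit set `Ω_𝒜 = 𝒬²(C²_𝒜 ∩ L²(T)) ⊆ T̄`: images of pairs of distinct boundary
points with distinct first letters (w.r.t. the basis `𝒜`) that are identified by `𝒬`. -/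
def limitSet {ι : Type} [DecidableEq ι] (St : TreeSetup ι) : Set St.Tb :=
  {Q | ∃ X Y : InfWord ι, X.letter 0 ≠ Y.letter 0 ∧ QRel St X Q ∧ QRel St Y Q}

/-- The heart `K_𝒜 ⊆ T̄`: the convex hull of the limit set `Ω_𝒜`. -/
def heart {ι : Type} [DecidableEq ι] (St : TreeSetup ι) : Set St.Tb :=
  subtreeHull (limitSet St)

/-- The dual algebraic lamination `L²(T) = {(X,Y) ∈ ∂²F_N : 𝒬(X) = 𝒬(Y)}`. -/
def L2 {ι : Type} [DecidableEq ι] (St : TreeSetup ι) : Set (InfWord ι × InfWord ι) :=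
  {p | p.1 ≠ p.2 ∧ ∃ Q : St.Tb, QRel St p.1 Q ∧ QRel St p.2 Q}

/-! ### The system of isometries induced on a compact subtree `K ⊆ T̄` -/

/-- The domain, inside `T̄`, of the partial isometry `x ↦ w⁻¹ x` of `K` induced by the word
`w`: the intersection of the translates of `K` by the prefixes of `w`. -/
def inducedDom {ι : Type} [DecidableEq ι] (St : TreeSetup ι) (K : Set St.Tb)
    (w : FreeGroup ι) : Set St.Tb :=
  ⋂ n ∈ Finset.range (w.toWord.length + 1), gprefix w n • K

/-- Admissibility of a word for the induced system of isometries `𝒦 = (K, 𝒜)`. -/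
def InducedAdmissible {ι : Type} [DecidableEq ι] (St : TreeSetup ι) (K : Set St.Tb)
    (w : FreeGroup ι) : Prop :=
  (inducedDom St K w).Nonempty

/-- The admissible laminary language `ℒ_adm(𝒦)` of the induced system `𝒦 = (K, 𝒜)`. -/
def inducedAdmLanguage {ι : Type} [DecidableEq ι] (St : TreeSetup ι) (K : Set St.Tb) :
    Set (FreeGroup ι) :=
  {w | ∀ k : ℕ, ∃ v : FreeGroup ι, InducedAdmissible St K v ∧
      ∃ p s : List (ι × Bool), p.length = k ∧ s.length = k ∧
        v.toWord = p ++ w.toWord ++ s}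

/-- Admissibility of an infinite word for the induced system `𝒦 = (K, 𝒜)`. -/
def InducedAdmissibleInf {ι : Type} [DecidableEq ι] (St : TreeSetup ι) (K : Set St.Tb)
    (X : InfWord ι) : Prop :=
  ∀ n, InducedAdmissible St K (X.prefixN n)

/-- The domain `dom(X) = ⋂ₙ dom(Xₙ)` of an infinite word, for the induced system. -/
def inducedDomInf {ι : Type} [DecidableEq ι] (St : TreeSetup ι) (K : Set St.Tb)
    (X : InfWord ι) : Set St.Tb :=
  ⋂ n, X.prefixN n • K

/-- Compatibility of a map `e : K → T'` with the system of partial isometries induced on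
`K ⊆ T̄` by the basis `𝒜`: this is condition (2) of Theorem 3.2 for the induced system. -/
def InducedCompat {ι : Type} (St : TreeSetup ι) (K : Set St.Tb) {T' : Type} [MetricSpace T']
    [MulAction (FreeGroup ι) T'] (e : K → T') : Prop :=
  ∀ (i : ι) (x : K) (h : (FreeGroup.of i)⁻¹ • (x : St.Tb) ∈ K),
    (FreeGroup.of i)⁻¹ • e x = e ⟨(FreeGroup.of i)⁻¹ • (x : St.Tb), h⟩

/-- The tree `T_𝒦` associated to the system of isometries induced on a compact subtree
`K ⊆ T̄`, presented through the characteristic properties of Theorem 3.2 (by which it is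
unique), together with the canonical `F(𝒜)`-equivariant morphism `j : T_𝒦 → T̄` restricting
to the identity on `K`. -/
structure InducedAssoc {ι : Type} (St : TreeSetup ι) (K : Set St.Tb) where
  TK : Type
  [ms : MetricSpace TK]
  tree : IsRTree TK
  [act : MulAction (FreeGroup ι) TK]
  act_isom : ∀ g : FreeGroup ι, Isometry fun x : TK => g • x
  emb : K → TK
  emb_isom : Isometry emb
  emb_subtree : IsSubtree (Set.range emb)
  compat : InducedCompat St K emb
  orbit_meets : ∀ p : TK, ∃ (w : FreeGroup ι) (x : K), p = w • emb x
  seg_cover : ∀ p q : TK, ∃ F : Finset (FreeGroup ι),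
      seg p q ⊆ ⋃ w ∈ F, w • Set.range emb
  universal : ∀ (T' : Type) [MetricSpace T'] [MulAction (FreeGroup ι) T'],
      (∀ g : FreeGroup ι, Isometry fun x : T' => g • x) →
      ∀ e' : K → T', Isometry e' → InducedCompat St K e' →
      ∃! f : TK → T', IsTreeMorphism f ∧
        (∀ (g : FreeGroup ι) (p : TK), f (g • p) = g • f p) ∧
        ∀ x : K, f (emb x) = e' x
  jmap : TK → St.Tb
  jmap_morphism : IsTreeMorphism jmap
  jmap_equivariant : ∀ (g : FreeGroup ι) (p : TK), jmap (g • p) = g • jmap p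
  jmap_emb : ∀ x : K, jmap (emb x) = (x : St.Tb)

attribute [instance] InducedAssoc.ms InducedAssoc.act

/-! ### Change of basis -/

/-- Changing the basis of the free group: the same tree, with the action precomposed with
the automorphism `φ` of `F(𝒜)`.  The heart of `St.twist φ` is the heart of `T` with respect
to the basis `φ(𝒜)`. -/
def TreeSetup.twist {ι : Type} (St : TreeSetup ι) (φ : FreeGroup ι ≃* FreeGroup ι) :
    TreeSetup ι where
  Tb := St.Tb
  ms := St.ms
  complete := St.complete
  tree := St.tree
  act := { smul := fun g x => φ g • x
           one_smul := fun x => by show φ 1 • x = x; rw [map_one, one_smul]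
           mul_smul := fun g h x => by
             show φ (g * h) • x = φ g • φ h • x
             rw [map_mul, mul_smul] }
  act_isom := fun g => St.act_isom (φ g)
  Tsub := St.Tsub
  nonempty := St.nonempty
  dense := St.dense
  sub_subtree := St.sub_subtree
  invariant := fun g x hx => St.invariant (φ g) x hx
  minimal := fun A hA hne hsub hinv => St.minimal A hA hne hsub (fun g x hx => by
    have h : φ (φ.symm g) • x ∈ A := hinv (φ.symm g) x hx
    rwa [MulEquiv.apply_symm_apply] at h)
  dense_orbits := fun x hx => by
    have hr : (Set.range fun g : FreeGroup ι => φ g • x) =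
        Set.range fun g : FreeGroup ι => g • x := by
      apply Set.ext; intro y
      constructor
      · rintro ⟨g, rfl⟩; exact ⟨φ g, rfl⟩
      · rintro ⟨g, rfl⟩; exact ⟨φ.symm g, by simp⟩
    show St.Tsub ⊆ closure (Set.range fun g : FreeGroup ι => φ g • x)
    rw [hr]; exact St.dense_orbits x hx
  arc_stab := fun g x hx y hy hxy him => by
    have h1 : φ g = 1 := St.arc_stab (φ g) x hx y hy hxy him
    have h2 := congrArg φ.symm h1
    simpa using h2

/-! ### The boundary `∂T`, the space `T̂ = T̄ ∪ ∂T` and the observers' topology -/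

/-- An isometric ray (parametrized on `[0,∞)`) in a metric space. -/
def IsRay {T : Type} [MetricSpace T] (r : ℝ → T) : Prop :=
  ∀ s t : ℝ, 0 ≤ s → 0 ≤ t → dist (r s) (r t) = |s - t|

/-- The type of isometric rays in `T`. -/
def Ray (T : Type) [MetricSpace T] : Type := {r : ℝ → T // IsRay r}

/-- Two rays define the same end iff they are at bounded distance. -/
def rayEnd (T : Type) [MetricSpace T] : Setoid (Ray T) where
  r := fun r₁ r₂ => ∃ C : ℝ, ∀ t : ℝ, 0 ≤ t → dist (r₁.1 t) (r₂.1 t) ≤ C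
  iseqv := by
    refine ⟨fun r => ⟨0, fun t _ => by simp⟩, ?_, ?_⟩
    · rintro r₁ r₂ ⟨C, hC⟩
      exact ⟨C, fun t ht => by rw [dist_comm]; exact hC t ht⟩
    · rintro r₁ r₂ r₃ ⟨C, hC⟩ ⟨D, hD⟩
      exact ⟨C + D, fun t ht =>
        (dist_triangle _ (r₂.1 t) _).trans (add_le_add (hC t ht) (hD t ht))⟩

/-- The Gromov boundary `∂T`: ends of `T`, i.e. classes of rays at bounded distance. -/
def GromovBoundary (T : Type) [MetricSpace T] : Type := Quotient (rayEnd T)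

/-- The space `T̂ = T̄ ∪ ∂T` (for `T` a complete ℝ-tree, representing the completion `T̄`). -/
def TreeHat (T : Type) [MetricSpace T] : Type := T ⊕ GromovBoundary T

/-- The segment `[x, ξ]` from a point `x ∈ T̄` to a boundary point `ξ ∈ ∂T`. -/
def raySeg {T : Type} [MetricSpace T] (x : T) (ξ : GromovBoundary T) : Set (TreeHat T) :=
  ({Sum.inr ξ} : Set (TreeHat T)) ∪ Sum.inl ''
    {p | ∃ r : Ray T, Quotient.mk (rayEnd T) r = ξ ∧ r.1 0 = x ∧ ∃ t : ℝ, 0 ≤ t ∧ r.1 t = p}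

/-- The segment `[ξ, η]` between two boundary points. -/
def lineSeg {T : Type} [MetricSpace T] (ξ η : GromovBoundary T) : Set (TreeHat T) :=
  ({Sum.inr ξ, Sum.inr η} : Set (TreeHat T)) ∪ Sum.inl ''
    {p | ∃ r r' : Ray T, Quotient.mk (rayEnd T) r = ξ ∧ Quotient.mk (rayEnd T) r' = η ∧
      r.1 0 = p ∧ r'.1 0 = p ∧ ∀ s t : ℝ, 0 ≤ s → 0 ≤ t → dist (r.1 s) (r'.1 t) = s + t}

/-- The segment `[P, Q]` between two points of `T̂ = T̄ ∪ ∂T`. -/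
def segHat {T : Type} [MetricSpace T] : TreeHat T → TreeHat T → Set (TreeHat T)
  | Sum.inl x, Sum.inl y => Sum.inl '' seg x y
  | Sum.inl x, Sum.inr ξ => raySeg x ξ
  | Sum.inr ξ, Sum.inl x => raySeg x ξ
  | Sum.inr ξ, Sum.inr η => lineSeg ξ η

/-- The observers' topology on `T̂`: generated by the set of directions, where the direction
at `P` containing `x` is the set of points `y` with `P ∉ [x,y]` (i.e. the connected component
of `T̂ ∖ {P}` containing `x`). -/
def observersTopology (T : Type) [MetricSpace T] : TopologicalSpace (TreeHat T) :=
  TopologicalSpace.generateFrom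
    {D | ∃ P x : TreeHat T, x ≠ P ∧ D = {y | y ≠ P ∧ P ∉ segHat x y}}

/-- The extension to `T̂ = T̄ ∪ ∂T` of an isometric action on `T̄`. -/
def TreeHat.smul {T : Type} [MetricSpace T] {G : Type} [Group G] [MulAction G T]
    (hiso : ∀ g : G, Isometry fun x : T => g • x) (g : G) : TreeHat T → TreeHat T
  | Sum.inl x => Sum.inl (g • x)
  | Sum.inr ξ => Sum.inr <| Quotient.map'
      (fun r : Ray T => (⟨fun t => g • r.1 t, fun s t hs ht => by
        have h := (hiso g).dist_eq (r.1 s) (r.1 t)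
        simpa using h.trans (r.2 s t hs ht)⟩ : Ray T))
      (fun r r' h => by
        obtain ⟨C, hC⟩ := h
        exact ⟨C, fun t ht => by
          have h' := (hiso g).dist_eq (r.1 t) (r'.1 t)
          simpa using h'.le.trans (hC t ht)⟩) ξ

/-! ### Laminations -/

/-- An algebraic lamination (as a set of pairs of boundary points) is closed by diagonal
leaves. -/
def ClosedByDiagonal {ι : Type} (L : Set (InfWord ι × InfWord ι)) : Prop :=
  ∀ X X' X'' : InfWord ι, (X, X') ∈ L → (X', X'') ∈ L → X = X'' ∨ (X, X'') ∈ L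

/-- Invariance of a lamination under the `F(𝒜)`-action on `∂²F(𝒜)`. -/
def InvariantLam {ι : Type} [DecidableEq ι] (L : Set (InfWord ι × InfWord ι)) : Prop :=
  ∀ (w : FreeGroup ι) (X X' Y Y' : InfWord ι), (X, X') ∈ L →
    SmulBoundary w X Y → SmulBoundary w X' Y' → (Y, Y') ∈ L

/-- Invariance of a lamination under the flip map. -/
def FlipInvariant {ι : Type} (L : Set (InfWord ι × InfWord ι)) : Prop :=
  ∀ X Y : InfWord ι, (X, Y) ∈ L → (Y, X) ∈ L

/-- The dual lamination `L²(T)` is minimal up to diagonal leaves: it contains no proper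
non-trivial sublamination that is closed by diagonal leaves. -/
def MinimalUpToDiagonal {ι : Type} [DecidableEq ι] (St : TreeSetup ι) : Prop :=
  ∀ L : Set (InfWord ι × InfWord ι), L ⊆ L2 St → L.Nonempty → IsClosed L →
    InvariantLam L → FlipInvariant L → ClosedByDiagonal L → L = L2 St

end CHL

namespace CHL

/-- Multiplying a reduced word on the right by a letter leaves its proper prefixes unchanged. -/
lemma take_toWord_mul_mk_singleton {ι : Type*} [DecidableEq ι] (g : FreeGroup ι) (x : ι × Bool)
    {k : ℕ} (hk : k < g.toWord.length) :
    (g * FreeGroup.mk [x]).toWord.take k = g.toWord.take k := by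
  have hred : FreeGroup.IsReduced g.toWord := FreeGroup.isReduced_toWord
  have hmul : (g * FreeGroup.mk [x]).toWord = FreeGroup.reduce (g.toWord ++ [x]) := by
    conv_lhs => rw [← FreeGroup.mk_toWord (x := g), FreeGroup.mul_mk, FreeGroup.toWord_mk]
  rw [hmul]
  generalize g.toWord = L at hk hred
  rcases List.eq_nil_or_concat L with rfl | ⟨L', y, rfl⟩
  · simp at hk
  rw [List.concat_eq_append] at hk hred ⊢
  have hk' : k ≤ L'.length := by
    rw [List.length_append, List.length_singleton] at hk
    omega
  by_cases hxy : y.1 = x.1 → y.2 = x.2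
  · have h : FreeGroup.IsReduced (L' ++ [y] ++ [x]) :=
      FreeGroup.IsReduced.append_overlap hred (by simpa [FreeGroup.IsReduced] using hxy) (by simp)
    rw [h.reduce_eq, List.take_append_of_le_length hk.le]
  · obtain ⟨a, b⟩ := x
    obtain ⟨c, d⟩ := y
    simp only [Classical.not_imp] at hxy
    obtain ⟨rfl, hd⟩ := hxy
    obtain rfl : b = !d := by cases b <;> cases d <;> simp_all
    have hstep : FreeGroup.Red.Step (L' ++ [(c, d)] ++ [(c, !d)]) L' := by
      simpa using FreeGroup.Red.Step.not (L₁ := L') (L₂ := []) (x := c) (b := d)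
    have hL' : FreeGroup.IsReduced L' := hred.infix (List.prefix_append L' _).isInfix
    rw [FreeGroup.reduce.Step.eq hstep, hL'.reduce_eq, List.take_append_of_le_length hk']

lemma TendstoBoundary.mul_mk_singleton {ι : Type*} [DecidableEq ι] {w : ℕ → FreeGroup ι}
    {X : InfWord ι} (hw : TendstoBoundary w X) (x : ι × Bool) :
    TendstoBoundary (fun n => w n * FreeGroup.mk [x]) X := by
  intro k
  filter_upwards [hw k, hw (k + 1)] with n hn hn'
  have hlen : k < (w n).toWord.length := by
    have := congrArg List.length hn'
    rw [List.length_take, List.length_ofFn] at this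
    omega
  rw [take_toWord_mul_mk_singleton _ _ hlen, hn]

/-- Right multiplication by a fixed element does not change the limit in `∂F(𝒜)`. -/
lemma TendstoBoundary.mul_right {ι : Type*} [DecidableEq ι] {w : ℕ → FreeGroup ι}
    {X : InfWord ι} (hw : TendstoBoundary w X) (v : FreeGroup ι) :
    TendstoBoundary (fun n => w n * v) X := by
  induction v using FreeGroup.induction_on generalizing w with
  | C1 => simpa using hw
  | of i => exact hw.mul_mk_singleton (i, true)
  | inv_of i _ => exact hw.mul_mk_singleton (i, false)
  | mul x y hx hy => simpa only [mul_assoc] using hy (hx hw)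

lemma TendstoBoundary.comp {ι : Type*} [DecidableEq ι] {w : ℕ → FreeGroup ι}
    {X : InfWord ι} (hw : TendstoBoundary w X) {φ : ℕ → ℕ} (hφ : Tendsto φ atTop atTop) :
    TendstoBoundary (w ∘ φ) X :=
  fun k => hφ.eventually (hw k)

/-- A sequence whose `m`-th term agrees with `X` up to length `m` converges to `X`. -/
lemma tendstoBoundary_of_take_eq {ι : Type*} [DecidableEq ι] {u : ℕ → FreeGroup ι}
    {X : InfWord ι}
    (h : ∀ m, (u m).toWord.take m = List.ofFn fun i : Fin m => X.letter i) :
    TendstoBoundary u X := by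
  intro k
  filter_upwards [eventually_ge_atTop k] with m hm
  have hk := congrArg (List.take k) (h m)
  rw [List.take_take, min_eq_left hm] at hk
  rw [hk]
  apply List.ext_getElem
  · simpa using hm
  · simp

lemma TreeSetup.dist_smul_left {ι : Type} (St : TreeSetup ι) (g : FreeGroup ι) (x y : St.Tb) :
    dist (g • x) y = dist x (g⁻¹ • y) := by
  simpa using (St.act_isom g).dist_eq x (g⁻¹ • y)

lemma TreeSetup.dense_orbit {ι : Type} (St : TreeSetup ι) {P : St.Tb} (hP : P ∈ St.Tsub) :
    Dense (Set.range fun g : FreeGroup ι => g • P) :=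
  (St.dense.mono (St.dense_orbits P hP)).of_closure

/-- If `wₙ → X` and `wₙ⁻¹ q` converges metrically, then some sequence converging to `X` moves
any given `P ∈ T` towards `q`. -/
lemma exists_tendstoBoundary_tendsto_smul {ι : Type} [DecidableEq ι] (St : TreeSetup ι)
    {w : ℕ → FreeGroup ι} {X : InfWord ι} (hw : TendstoBoundary w X) {q p P : St.Tb}
    (hp : Tendsto (fun n => (w n)⁻¹ • q) atTop (𝓝 p)) (hP : P ∈ St.Tsub) :
    ∃ u : ℕ → FreeGroup ι, TendstoBoundary u X ∧ Tendsto (fun n => u n • P) atTop (𝓝 q) := by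
  have hstep (m : ℕ) : ∃ g : FreeGroup ι,
      (g.toWord.take m = List.ofFn fun i : Fin m => X.letter i) ∧
        dist (g • P) q ≤ 2 * (1 / ((m : ℝ) + 1)) := by
    have hε : (0 : ℝ) < 1 / ((m : ℝ) + 1) := Nat.one_div_pos_of_nat
    obtain ⟨_, ⟨v, rfl⟩, hv⟩ := (St.dense_orbit hP).exists_dist_lt p hε
    obtain ⟨n, hn, hn'⟩ := ((hw.mul_right v m).and (Metric.tendsto_nhds.1 hp _ hε)).exists
    refine ⟨w n * v, hn, ?_⟩
    rw [mul_smul, St.dist_smul_left]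
    rw [dist_comm] at hv hn'
    linarith [dist_triangle (v • P) p ((w n)⁻¹ • q)]
  choose u hu hd using hstep
  refine ⟨u, tendstoBoundary_of_take_eq hu, tendsto_iff_dist_tendsto_zero.2 ?_⟩
  refine squeeze_zero (fun _ => dist_nonneg) hd ?_
  simpa using tendsto_one_div_add_atTop_nhds_zero_nat.const_mul (2 : ℝ)

/-- **Lemma 2.6.**  Let `𝒬 : ∂F_N → T̂` be a map such that whenever `uₙ → X ∈ ∂F_N` and
`uₙ P` converges metrically in `T̄` to `Q₀` (for `P ∈ T`), one has `𝒬(X) = Q₀`.  If `K` is a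
compact subtree of `T̄`, `Q ∈ K`, and `wₙ → X ∈ ∂F_N` with `wₙ⁻¹ Q ∈ K` for all `n`, then
`𝒬(X) = Q`. -/
theorem Q_of_returning_sequence {ι : Type} [Fintype ι] [DecidableEq ι]
    (hrank : 2 ≤ Fintype.card ι) (St : TreeSetup ι)
    (Q : InfWord ι → TreeHat St.Tb)
    (hQ : ∀ (u : ℕ → FreeGroup ι) (X : InfWord ι), TendstoBoundary u X →
        ∀ P ∈ St.Tsub, ∀ Q0 : St.Tb,
          Filter.Tendsto (fun n => u n • P) Filter.atTop (𝓝 Q0) → Q X = Sum.inl Q0)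
    (K : Set St.Tb) (hKcomp : IsCompact K) (hKtree : IsClosedSubtree K)
    (q : St.Tb) (hq : q ∈ K) (w : ℕ → FreeGroup ι) (X : InfWord ι)
    (hw : TendstoBoundary w X) (hret : ∀ n, (w n)⁻¹ • q ∈ K) :
    Q X = Sum.inl q := by
  obtain ⟨p, -, φ, hφ, hp⟩ := hKcomp.tendsto_subseq hret
  obtain ⟨P, hP⟩ := St.nonempty
  obtain ⟨u, hu, huP⟩ :=
    exists_tendstoBoundary_tendsto_smul St (hw.comp hφ.tendsto_atTop) hp hP
  exact hQ u X hu P hP q huP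

end CHL
end
end

section
/- Let 𝒦 = (K,𝒜) be a system of isometries. Then there exists an ℝ-tree T_𝒦, equipped with an isometric left action of the free group F(𝒜), unique with these properties, such that: (1) T_𝒦 contains K as an isometrically embedded subtree; (2) if x ∈ K is in the domain of a ∈ 𝒜, then a⁻¹x = x·a; (3) every orbit of the F(𝒜)-action on T_𝒦 meets K, and every segment of T_𝒦 is contained in a finite union of translates wᵢK with wᵢ ∈ F(𝒜); (4) if T is another ℝ-tree with an isometric F(𝒜)-action satisfying (1) and (2), then there exists a unique F(𝒜)-equivariant morphism j : T_𝒦 → T such that j(x) = x for all x ∈ K. -/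
/-!
Common formalization framework for "ℝ-trees, dual laminations, and compact systems
of partial isometries" (Coulbois–Hilion–Lustig).
-/

open Set Filter Topology Pointwise

noncomputable section

namespace CHL

/-! ### The four point condition -/

/-- The four point condition on a given quadruple, in all three pairings. -/
def FourPoint {P : Type*} [PseudoMetricSpace P] (x y z w : P) : Prop :=
  dist x y + dist z w ≤ max (dist x z + dist y w) (dist x w + dist y z) ∧
  dist x z + dist y w ≤ max (dist x y + dist z w) (dist x w + dist y z) ∧
  dist x w + dist y z ≤ max (dist x y + dist z w) (dist x z + dist y w)

section FourPoint

variable {P : Type*} [PseudoMetricSpace P] {x y z w : P}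

theorem FourPoint.swap_left (h : FourPoint x y z w) : FourPoint y x z w := by
  obtain ⟨h₁, h₂, h₃⟩ := h
  refine ⟨?_, ?_, ?_⟩ <;> simp only [dist_comm y x] <;>
    grind

theorem FourPoint.swap_pairs (h : FourPoint x y z w) : FourPoint z w x y := by
  obtain ⟨h₁, h₂, h₃⟩ := h
  refine ⟨?_, ?_, ?_⟩ <;>
    simp only [dist_comm z x, dist_comm w y, dist_comm z y, dist_comm w x] <;> grind

theorem FourPoint.swap_middle (h : FourPoint x y z w) : FourPoint x z y w := by
  obtain ⟨h₁, h₂, h₃⟩ := h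
  refine ⟨?_, ?_, ?_⟩ <;> simp only [dist_comm z y] <;> grind

/-- Moving one of the four points away from the others preserves the four point condition. -/
theorem FourPoint.of_gate {p g : P} (h : FourPoint g y z w)
    (hy : dist p y = dist p g + dist g y) (hz : dist p z = dist p g + dist g z)
    (hw : dist p w = dist p g + dist g w) : FourPoint p y z w := by
  obtain ⟨h₁, h₂, h₃⟩ := h
  simp only [FourPoint, hy, hz, hw]
  grind

theorem FourPoint.of_dist_eq_zero {p g : P} (h : FourPoint g y z w) (h0 : dist p g = 0) :
    FourPoint p y z w := by
  have key : ∀ x, dist p x = dist p g + dist g x := fun x => by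
    have := dist_triangle p g x
    have := dist_triangle g p x
    rw [dist_comm g p] at this
    linarith
  exact h.of_gate (key y) (key z) (key w)

theorem FourPoint.of_two_gates {p q P' Q' s t : P} (h : FourPoint P' Q' s t)
    (hpq : FourPoint p q P' Q')
    (hpQ : dist p Q' = dist p P' + dist P' Q') (hqP : dist q P' = dist q Q' + dist Q' P')
    (hps : dist p s = dist p P' + dist P' s) (hpt : dist p t = dist p P' + dist P' t)
    (hqs : dist q s = dist q Q' + dist Q' s) (hqt : dist q t = dist q Q' + dist Q' t) :
    FourPoint p q s t := by
  obtain ⟨h₁, h₂, h₃⟩ := h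
  have h₄ := hpq.2.2
  have t₁ := dist_triangle p P' q
  have t₂ := dist_triangle P' Q' q
  have t₃ := dist_triangle P' Q' s
  have t₄ := dist_triangle P' Q' t
  have t₅ := dist_triangle Q' P' s
  have t₆ := dist_triangle Q' P' t
  have t₇ := dist_triangle s P' t
  have t₈ := dist_triangle s Q' t
  rw [dist_comm P' q] at t₁
  rw [dist_comm Q' q] at t₂
  rw [dist_comm Q' P'] at *
  rw [dist_comm s P'] at t₇
  rw [dist_comm s Q'] at t₈
  have := dist_nonneg (x := P') (y := Q')
  simp only [FourPoint, hps, hpt, hqs, hqt]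
  rcases this.eq_or_lt with h0 | h0
  · grind
  · have : dist p q = dist p P' + dist P' Q' + dist q Q' := by grind
    rw [this]
    grind

/-- Gluing two `0`-hyperbolic sets `X`, `Y`, each of which has gates in the other, where the gates
of points of `Y` lie in both sets up to distance zero. -/
theorem fourPoint_union {X Y : Set P}
    (hX : ∀ x ∈ X, ∀ y ∈ X, ∀ z ∈ X, ∀ w ∈ X, FourPoint x y z w)
    (hY : ∀ x ∈ Y, ∀ y ∈ Y, ∀ z ∈ Y, ∀ w ∈ Y, FourPoint x y z w)
    (gX : ∀ p ∈ Y, ∃ g ∈ X, (∃ h ∈ Y, dist g h = 0) ∧ ∀ x ∈ X, dist p x = dist p g + dist g x)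
    (gY : ∀ p ∈ X, ∃ g ∈ Y, ∀ x ∈ Y, dist p x = dist p g + dist g x) :
    ∀ x ∈ X ∪ Y, ∀ y ∈ X ∪ Y, ∀ z ∈ X ∪ Y, ∀ w ∈ X ∪ Y, FourPoint x y z w := by
  have one : ∀ p ∈ Y, ∀ x ∈ X, ∀ y ∈ X, ∀ z ∈ X, FourPoint p x y z := by
    intro p hp x hx y hy z hz
    obtain ⟨g, hg, -, h⟩ := gX p hp
    exact (hX g hg x hx y hy z hz).of_gate (h x hx) (h y hy) (h z hz)
  have three : ∀ p ∈ X, ∀ x ∈ Y, ∀ y ∈ Y, ∀ z ∈ Y, FourPoint p x y z := by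
    intro p hp x hx y hy z hz
    obtain ⟨g, hg, h⟩ := gY p hp
    exact (hY g hg x hx y hy z hz).of_gate (h x hx) (h y hy) (h z hz)
  have two : ∀ p ∈ Y, ∀ q ∈ Y, ∀ s ∈ X, ∀ t ∈ X, FourPoint p q s t := by
    intro p hp q hq s hs t ht
    obtain ⟨g, hg, ⟨b, hb, hgb⟩, h⟩ := gX p hp
    obtain ⟨g', hg', ⟨b', hb', hgb'⟩, h'⟩ := gX q hq
    have hb4 := (hY b hb b' hb' p hp q hq).of_dist_eq_zero hgb
    exact (hX g hg g' hg' s hs t ht).of_two_gates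
      (hb4.swap_left.of_dist_eq_zero hgb').swap_left.swap_pairs
      (h g' hg') (h' g hg) (h s hs) (h t ht) (h' s hs) (h' t ht)
  intro x hx y hy z hz w hw
  rcases hx with hx | hx <;> rcases hy with hy | hy <;> rcases hz with hz | hz <;>
    rcases hw with hw | hw
  · exact hX x hx y hy z hz w hw
  · exact (one w hw z hz x hx y hy).swap_left.swap_pairs
  · exact (one z hz w hw x hx y hy).swap_pairs
  · exact (two z hz w hw x hx y hy).swap_pairs
  · exact (one y hy x hx z hz w hw).swap_left
  · exact (two y hy w hw x hx z hz).swap_pairs.swap_middle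
  · exact (two y hy z hz x hx w hw).swap_middle.swap_left
  · exact three x hx y hy z hz w hw
  · exact one x hx y hy z hz w hw
  · exact (two x hx w hw y hy z hz).swap_middle.swap_pairs.swap_left.swap_pairs
  · exact (two x hx z hz y hy w hw).swap_middle
  · exact (three y hy x hx z hz w hw).swap_left
  · exact two x hx y hy z hz w hw
  · exact (three z hz w hw x hx y hy).swap_pairs
  · exact (three w hw z hz x hx y hy).swap_left.swap_pairs
  · exact hY x hx y hy z hz w hw

end FourPoint

theorem IsRTree.fourPoint {T : Type*} [MetricSpace T] [IsRTree T] (x y z w : T) :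
    FourPoint x y z w := by
  have h₁ := IsRTree.four_point x y z w
  have h₂ := IsRTree.four_point x z y w
  have h₃ := IsRTree.four_point x w y z
  rw [dist_comm z y] at h₂
  rw [dist_comm w z, dist_comm w y] at h₃
  exact ⟨h₁, h₂, h₃⟩

/-! ### Segments and projections in ℝ-trees -/

/-- Two points are joined by a geodesic segment. -/
def GeodesicallyJoined {T : Type*} [MetricSpace T] (x y : T) : Prop :=
  ∃ f : ℝ → T, f 0 = x ∧ f (dist x y) = y ∧
    ∀ s ∈ Set.Icc (0 : ℝ) (dist x y), ∀ t ∈ Set.Icc (0 : ℝ) (dist x y),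
      dist (f s) (f t) = |s - t|

theorem GeodesicallyJoined.map {T T' : Type*} [MetricSpace T] [MetricSpace T'] {e : T → T'}
    (he : Isometry e) {x y : T} (h : GeodesicallyJoined x y) :
    GeodesicallyJoined (e x) (e y) := by
  obtain ⟨f, h0, h1, hf⟩ := h
  refine ⟨e ∘ f, by simp [h0], by simp [he.dist_eq, h1], ?_⟩
  simpa [he.dist_eq] using hf

theorem GeodesicallyJoined.concat {T : Type*} [MetricSpace T] {x m y : T}
    (h : GeodesicallyJoined x m) (h' : GeodesicallyJoined m y) (hm : m ∈ seg x y) :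
    GeodesicallyJoined x y := by
  obtain ⟨f, f0, f1, hf⟩ := h
  obtain ⟨g, g0, g1, hg⟩ := h'
  have hm : dist x m + dist m y = dist x y := hm
  have hxm := dist_nonneg (x := x) (y := m)
  have hmy := dist_nonneg (x := m) (y := y)
  have key : ∀ s t : ℝ, 0 ≤ s → s ≤ dist x m → dist x m ≤ t → t ≤ dist x y →
      dist (f s) (g (t - dist x m)) = t - s := by
    intro s t h0 h1 h2 h3
    have a₁ := hf s ⟨h0, h1⟩ (dist x m) ⟨hxm, le_rfl⟩
    have a₂ := hf 0 ⟨le_rfl, hxm⟩ s ⟨h0, h1⟩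
    have a₃ := hg 0 ⟨le_rfl, hmy⟩ (t - dist x m) ⟨by linarith, by linarith⟩
    have a₄ := hg (t - dist x m) ⟨by linarith, by linarith⟩ (dist m y) ⟨hmy, le_rfl⟩
    rw [f1, abs_of_nonpos (by linarith)] at a₁
    rw [f0, abs_of_nonpos (by linarith)] at a₂
    rw [g0, abs_of_nonpos (by linarith)] at a₃
    rw [g1, abs_of_nonpos (by linarith)] at a₄
    have b₁ := dist_triangle (f s) m (g (t - dist x m))
    have b₂ := dist_triangle x (f s) y
    have b₃ := dist_triangle (f s) (g (t - dist x m)) y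
    apply le_antisymm <;> linarith
  refine ⟨fun t => if t ≤ dist x m then f t else g (t - dist x m), ?_, ?_, ?_⟩
  · simp [f0]
  · dsimp only
    split_ifs with h
    · have : dist m y = 0 := by linarith
      rw [show dist x y = dist x m by linarith, f1]
      exact dist_eq_zero.mp this
    · rw [← hm, add_sub_cancel_left, g1]
  · rintro s ⟨hs0, hs1⟩ t ⟨ht0, ht1⟩
    dsimp only
    split_ifs with h1 h2 h2
    · exact hf s ⟨hs0, h1⟩ t ⟨ht0, h2⟩
    · rw [key s t hs0 h1 (by linarith) ht1, abs_of_nonpos (by linarith)]; ring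
    · rw [dist_comm, key t s ht0 h2 (by linarith) hs1, abs_of_nonneg (by linarith)]
    · rw [hg _ ⟨by linarith, by linarith⟩ _ ⟨by linarith, by linarith⟩]
      congr 1; ring

theorem seg_subset_union {T : Type*} [MetricSpace T]
    (h4 : ∀ x y z w : T, dist x y + dist z w ≤ max (dist x z + dist y w) (dist x w + dist y z))
    {p m q : T} (hm : m ∈ seg p q) : seg p q ⊆ seg p m ∪ seg m q := by
  intro z hz
  have hm : dist p m + dist m q = dist p q := hm
  have hz : dist p z + dist z q = dist p q := hz
  have h := h4 p q z m
  have t₁ := dist_triangle p z m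
  have t₂ := dist_triangle m z q
  rw [dist_comm q m, dist_comm q z] at h
  rw [dist_comm m z] at t₂
  change dist p z + dist z m = dist p m ∨ dist m z + dist z q = dist m q
  rw [dist_comm m z]
  rcases le_max_iff.mp h with h | h
  · right; linarith
  · left; linarith

section RTree

variable {T : Type*} [MetricSpace T] [IsRTree T]

theorem exists_dist_eq_of_le (x y : T) {t : ℝ} (h0 : 0 ≤ t) (h1 : t ≤ dist x y) :
    ∃ z, dist x z = t ∧ dist z y = dist x y - t := by
  obtain ⟨f, f0, f1, hf⟩ := IsRTree.geodesic x y
  refine ⟨f t, ?_, ?_⟩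
  · have := hf 0 ⟨le_rfl, dist_nonneg⟩ t ⟨h0, h1⟩
    rw [f0] at this
    rw [this, zero_sub, abs_neg, abs_of_nonneg h0]
  · have := hf t ⟨h0, h1⟩ (dist x y) ⟨dist_nonneg, le_rfl⟩
    rw [f1] at this
    rw [this, abs_of_nonpos (by linarith)]; ring

theorem dist_of_mem_seg {p q z z' : T} (hz : z ∈ seg p q) (hz' : z' ∈ seg p q) :
    dist z z' = |dist p z - dist p z'| := by
  have hz' : dist p z' + dist z' q = dist p q := hz'
  have hz : dist p z + dist z q = dist p q := hz
  have h := IsRTree.four_point p q z z'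
  have t₁ := dist_triangle p z z'
  have t₂ := dist_triangle p z' z
  rw [dist_comm q z', dist_comm q z] at h
  rw [dist_comm z' z] at t₂
  rcases le_max_iff.mp h with h | h
  · rw [abs_of_nonneg] <;> linarith [dist_nonneg (x := z) (y := z')]
  · rw [abs_of_nonpos] <;> linarith [dist_nonneg (x := z) (y := z')]

/-- An isometric image of an ℝ-tree is convex. -/
theorem isSubtree_range {K : Type*} [MetricSpace K] [IsRTree K] {e : K → T} (he : Isometry e) :
    IsSubtree (range e) := by
  rintro _ ⟨x, rfl⟩ _ ⟨y, rfl⟩ z hz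
  have hz' : dist (e x) z + dist z (e y) = dist (e x) (e y) := hz
  rw [he.dist_eq] at hz'
  obtain ⟨m, h₁, h₂⟩ := exists_dist_eq_of_le x y (t := dist (e x) z) dist_nonneg
    (by linarith [dist_nonneg (x := z) (y := e y)])
  have hm : e m ∈ seg (e x) (e y) := by
    change dist _ _ + dist _ _ = dist _ _
    rw [he.dist_eq, he.dist_eq, he.dist_eq]; linarith
  have := dist_of_mem_seg hm hz
  rw [he.dist_eq, h₁, sub_self, abs_zero] at this
  exact ⟨m, dist_eq_zero.mp this⟩

/-- The projection of a point onto a compact subtree. -/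
theorem exists_gate {A : Set T} (hc : IsCompact A) (hne : A.Nonempty) (hA : IsSubtree A)
    (x : T) : ∃ g ∈ A, ∀ a ∈ A, dist x a = dist x g + dist g a := by
  obtain ⟨g, hg, hmin⟩ := hc.exists_isMinOn hne (f := fun a => dist x a) (by fun_prop)
  refine ⟨g, hg, fun a ha => le_antisymm (dist_triangle _ _ _) ?_⟩
  have t₁ := dist_triangle x a g
  have t₂ := dist_triangle g x a
  have t₃ := dist_triangle x g a
  rw [dist_comm a g] at t₁
  rw [dist_comm g x] at t₂
  obtain ⟨m, hm₁, hm₂⟩ := exists_dist_eq_of_le g a (t := (dist x g + dist g a - dist x a) / 2)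
    (by linarith) (by linarith)
  have hmA : m ∈ A := hA g hg a ha (by change dist _ _ + dist _ _ = dist _ _; linarith)
  have h := IsRTree.four_point x m g a
  rw [dist_comm m g, hm₁, hm₂] at h
  have h' : dist x g ≤ dist x m := hmin hmA
  rcases le_max_iff.mp h with h | h <;> linarith

/-- A map which is isometric on each of finitely many compact subtrees covering a segment does
not increase the distance between the endpoints of this segment. -/
theorem dist_le_of_seg_subset {T' : Type*} [MetricSpace T'] {f : T → T'} {α : Type*}
    {C : α → Set T} (hC : ∀ a, IsCompact (C a))
    (hf : ∀ a, ∀ x ∈ C a, ∀ y ∈ C a, dist (f x) (f y) = dist x y)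
    (F : Finset α) : ∀ p q : T, seg p q ⊆ ⋃ a ∈ F, C a → dist (f p) (f q) ≤ dist p q := by
  classical
  induction F using Finset.strongInduction with
  | H F ih =>
    intro p q hF
    have hp : p ∈ seg p q := by simp [seg]
    obtain ⟨a, ha, hpa⟩ : ∃ a ∈ F, p ∈ C a := by simpa using hF hp
    have hsc : IsClosed (seg p q) := isClosed_eq (by fun_prop) (by fun_prop)
    obtain ⟨b, ⟨hba, hb⟩, hmax⟩ := ((hC a).inter_right hsc).exists_isMaxOn ⟨p, hpa, hp⟩
      (f := fun z => dist p z) (by fun_prop)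
    have hb' : dist p b + dist b q = dist p q := hb
    have sub : ∀ z ∈ seg b q, z ∈ seg p q ∧ dist p z = dist p b + dist b z := by
      intro z hz
      have hz : dist b z + dist z q = dist b q := hz
      have t₁ := dist_triangle p z q
      have t₂ := dist_triangle p b z
      exact ⟨by change dist _ _ + dist _ _ = dist _ _; linarith, by linarith⟩
    have cov : ∀ z ∈ seg b q, z ≠ b → z ∈ ⋃ c ∈ F.erase a, C c := by
      intro z hz hzb
      obtain ⟨c, hc, hzc⟩ : ∃ c ∈ F, z ∈ C c := by simpa using hF (sub z hz).1
      have hca : c ≠ a := by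
        rintro rfl
        have h₁ : dist p z ≤ dist p b := hmax ⟨hzc, (sub z hz).1⟩
        have h₂ := (sub z hz).2
        exact hzb (dist_le_zero.mp (by rw [dist_comm]; linarith))
      simp only [mem_iUnion]
      exact ⟨c, Finset.mem_erase.mpr ⟨hca, hc⟩, hzc⟩
    have h₁ := hf a p hpa b hba
    have h₂ : dist (f b) (f q) ≤ dist b q := by
      rcases eq_or_ne b q with rfl | hbq
      · simp
      refine ih _ (Finset.erase_ssubset ha) b q fun z hz => ?_
      rcases eq_or_ne z b with rfl | hzb
      · have hcl : IsClosed (⋃ c ∈ F.erase a, C c) :=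
          (F.erase a).isCompact_biUnion (fun c _ => hC c) |>.isClosed
        rw [← hcl.closure_eq, Metric.mem_closure_iff]
        intro ε hε
        have hd := dist_pos.mpr hbq
        obtain ⟨m, hm₁, hm₂⟩ := exists_dist_eq_of_le z q (t := min (ε / 2) (dist z q))
          (by positivity) (min_le_right _ _)
        refine ⟨m, cov m (by change dist _ _ + dist _ _ = dist _ _; linarith) ?_, ?_⟩
        · rintro rfl
          rw [dist_self] at hm₁
          have : 0 < min (ε / 2) (dist m q) := by positivity
          linarith
        · rw [hm₁]; exact (min_le_left _ _).trans_lt (by linarith)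
      · exact cov z hz hzb
    linarith [dist_triangle (f p) (f b) (f q)]

/-- A continuous map which is injective on subtrees, finitely many of which suffice to cover any
given segment, is a morphism. -/
theorem isTreeMorphism_of_cover {T' : Type*} [MetricSpace T'] {f : T → T'} (hfc : Continuous f)
    {α : Type*} {C : α → Set T} (hC : ∀ a, IsCompact (C a)) (hCs : ∀ a, IsSubtree (C a))
    (hf : ∀ a, InjOn f (C a)) (hcov : ∀ p q : T, ∃ F : Finset α, seg p q ⊆ ⋃ a ∈ F, C a) :
    IsTreeMorphism f := by
  classical
  refine ⟨hfc, fun p q => ?_⟩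
  obtain ⟨F, hF⟩ := hcov p q
  have hsc : IsClosed (seg p q) := isClosed_eq (by fun_prop) (by fun_prop)
  have hext : ∀ a, ∃ u v : T, ∀ z ∈ C a ∩ seg p q, u ∈ C a ∩ seg p q ∧ v ∈ C a ∩ seg p q ∧
      dist p u ≤ dist p z ∧ dist p z ≤ dist p v := by
    intro a
    by_cases hne : (C a ∩ seg p q).Nonempty
    · have hc := (hC a).inter_right hsc
      obtain ⟨u, hu, hmin⟩ := hc.exists_isMinOn hne (f := fun z => dist p z) (by fun_prop)
      obtain ⟨v, hv, hmax⟩ := hc.exists_isMaxOn hne (f := fun z => dist p z) (by fun_prop)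
      exact ⟨u, v, fun z hz => ⟨hu, hv, hmin hz, hmax hz⟩⟩
    · exact ⟨p, p, fun z hz => absurd ⟨z, hz⟩ hne⟩
  choose u v huv using hext
  refine ⟨F.image u ∪ F.image v, fun z hz hzF => ?_⟩
  obtain ⟨a, ha, hza⟩ : ∃ a ∈ F, z ∈ C a := by simpa using hF hz
  obtain ⟨hu, hv, h₁, h₂⟩ := huv a z ⟨hza, hz⟩
  have hzu : z ≠ u a := by
    rintro rfl
    exact hzF (by simp only [Finset.coe_union, Finset.coe_image]; exact Or.inl ⟨a, ha, rfl⟩)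
  have hzv : z ≠ v a := by
    rintro rfl
    exact hzF (by simp only [Finset.coe_union, Finset.coe_image]; exact Or.inr ⟨a, ha, rfl⟩)
  have h₁' : dist p (u a) < dist p z := by
    refine lt_of_le_of_ne h₁ fun h => hzu ?_
    have := dist_of_mem_seg hz hu.2
    rw [h, sub_self, abs_zero] at this
    exact dist_eq_zero.mp this
  have h₂' : dist p z < dist p (v a) := by
    refine lt_of_le_of_ne h₂ fun h => hzv ?_
    have := dist_of_mem_seg hz hv.2
    rw [h, sub_self, abs_zero] at this
    exact dist_eq_zero.mp this
  have hopen : IsOpen ({y : T | dist p (u a) < dist p y} ∩ {y | dist p y < dist p (v a)}) :=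
    (isOpen_lt (by fun_prop) (by fun_prop)).inter (isOpen_lt (by fun_prop) (by fun_prop))
  refine ⟨seg p q ∩ ({y | dist p (u a) < dist p y} ∩ {y | dist p y < dist p (v a)}),
    inter_mem_nhdsWithin _ (hopen.mem_nhds ⟨h₁', h₂'⟩), (hf a).mono ?_⟩
  rintro y ⟨hy, hy₁, hy₂⟩
  change dist p (u a) < dist p y at hy₁
  change dist p y < dist p (v a) at hy₂
  refine hCs a _ hu.1 _ hv.1 ?_
  change dist _ _ + dist _ _ = dist _ _
  rw [dist_of_mem_seg hu.2 hy, dist_of_mem_seg hy hv.2, dist_of_mem_seg hu.2 hv.2,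
    abs_of_neg (by linarith), abs_of_neg (by linarith), abs_of_neg (by linarith)]
  ring

end RTree

/-! ### Reduced words -/

/-- The inverse letter. -/
def invLetter {ι : Type*} (z : ι × Bool) : ι × Bool := (z.1, !z.2)

theorem mk_singleton_invLetter {ι : Type*} (z : ι × Bool) :
    (FreeGroup.mk [invLetter z] : FreeGroup ι) = (FreeGroup.mk [z])⁻¹ := by
  simp [invLetter, FreeGroup.inv_mk, FreeGroup.invRev]

section Words

variable {ι : Type*} [DecidableEq ι]

theorem toWord_eq_of_mk {w : FreeGroup ι} {L : List (ι × Bool)} (hL : FreeGroup.IsReduced L)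
    (h : w = FreeGroup.mk L) : w.toWord = L := by
  rw [h, FreeGroup.toWord_mk, hL.reduce_eq]

theorem toWord_mul_letter (w : FreeGroup ι) (z : ι × Bool) :
    (w * FreeGroup.mk [z]).toWord = w.toWord ++ [z] ∨
    w.toWord = (w * FreeGroup.mk [z]).toWord ++ [invLetter z] := by
  have hw : FreeGroup.IsReduced w.toWord := FreeGroup.isReduced_toWord
  rcases List.eq_nil_or_concat w.toWord with h | ⟨L, b, h⟩
  · left
    rw [h]
    have : w = 1 := FreeGroup.toWord_eq_nil_iff.mp h
    exact toWord_eq_of_mk FreeGroup.IsReduced.singleton (by simp [this])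
  · rw [List.concat_eq_append] at h
    by_cases hb : b = invLetter z
    · right
      have hL : (w * FreeGroup.mk [z]).toWord = L := by
        refine toWord_eq_of_mk (hw.infix ?_) ?_
        · rw [h]; exact (List.prefix_append _ _).isInfix
        · rw [← FreeGroup.mk_toWord (x := w), h, ← FreeGroup.mul_mk, hb,
            mk_singleton_invLetter, inv_mul_cancel_right]
      rw [hL, h, hb]
    · left
      refine toWord_eq_of_mk ?_ (by rw [← FreeGroup.mul_mk, FreeGroup.mk_toWord])
      rw [h]
      refine FreeGroup.IsReduced.append_overlap (h ▸ hw) ?_ (by simp)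
      simp only [List.cons_append, List.nil_append, FreeGroup.IsReduced, List.isChain_cons_cons,
        List.isChain_singleton, and_true]
      intro h₁
      by_contra h₂
      exact hb (Prod.ext h₁ (by simpa [invLetter, Bool.eq_not] using h₂))

theorem eq_of_toWord_mul_letter {w v v' : FreeGroup ι} {z : ι × Bool}
    (hv : v.toWord = v'.toWord ++ [z]) (hlen : w.toWord.length ≤ v.toWord.length)
    (h : (w⁻¹ * v').toWord = (w⁻¹ * v).toWord ++ [invLetter z]) : w = v := by
  have hu : (v'⁻¹ * w).toWord = z :: FreeGroup.invRev (w⁻¹ * v).toWord := by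
    rw [show v'⁻¹ * w = (w⁻¹ * v')⁻¹ by group, FreeGroup.toWord_inv, h]
    simp [FreeGroup.invRev, invLetter]
  have hw : w.toWord = v'.toWord ++ ([z] ++ FreeGroup.invRev (w⁻¹ * v).toWord) := by
    refine toWord_eq_of_mk ?_ ?_
    · rw [← List.append_assoc]
      refine FreeGroup.IsReduced.append_overlap (hv ▸ FreeGroup.isReduced_toWord) ?_ (by simp)
      rw [List.singleton_append, ← hu]
      exact FreeGroup.isReduced_toWord
    · rw [List.singleton_append, ← hu, ← FreeGroup.mul_mk, FreeGroup.mk_toWord,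
        FreeGroup.mk_toWord]
      group
  have hl := congrArg List.length hw
  rw [hv] at hlen
  simp only [List.length_append, List.length_singleton, FreeGroup.invRev_length] at hl hlen
  have h1 : (w⁻¹ * v).toWord.length = 0 := by omega
  have h2 : w⁻¹ * v = 1 := FreeGroup.toWord_eq_nil_iff.mp (List.length_eq_zero_iff.mp h1)
  exact inv_mul_eq_one.mp h2

end Words

/-! ### Construction of the associated tree -/

namespace SystemOfIsometries

section Letters

variable {K : Type*} [MetricSpace K] {ι : Type*} (S : SystemOfIsometries K ι)

theorem letterPE_invLetter (z : ι × Bool) : S.letterPE (invLetter z) = (S.letterPE z).symm := by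
  obtain ⟨i, _ | _⟩ := z <;> rfl

theorem isClosedSubtree_source (z : ι × Bool) : IsClosedSubtree (S.letterPE z).source := by
  obtain ⟨i, _ | _⟩ := z
  · exact S.target_subtree i
  · exact S.source_subtree i

theorem dist_letterPE (z : ι × Bool) {x y : K} (hx : x ∈ (S.letterPE z).source)
    (hy : y ∈ (S.letterPE z).source) : dist (S.letterPE z x) (S.letterPE z y) = dist x y := by
  obtain ⟨i, _ | _⟩ := z
  · have h := S.isom i _ ((S.pe i).map_target hx) _ ((S.pe i).map_target hy)
    rw [(S.pe i).right_inv hx, (S.pe i).right_inv hy] at h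
    exact h.symm
  · exact S.isom i x hx y hy

end Letters

section Gate

variable {K : Type*} [MetricSpace K] [CompactSpace K] [IsRTree K] {ι : Type*}
  (S : SystemOfIsometries K ι)

theorem exists_proj (z : ι × Bool) (x : K) : ∃ g ∈ (S.letterPE z).source,
    ∀ a ∈ (S.letterPE z).source, dist x a = dist x g + dist g a := by
  obtain ⟨hne, hcl, hs⟩ := S.isClosedSubtree_source z
  exact exists_gate hcl.isCompact hne hs x

/-- The projection of `K` onto the domain of a letter. -/
def proj (z : ι × Bool) (x : K) : K := (S.exists_proj z x).choose

theorem proj_mem (z : ι × Bool) (x : K) : S.proj z x ∈ (S.letterPE z).source :=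
  (S.exists_proj z x).choose_spec.1

theorem dist_proj (z : ι × Bool) (x : K) {a : K} (ha : a ∈ (S.letterPE z).source) :
    dist x a = dist x (S.proj z x) + dist (S.proj z x) a :=
  (S.exists_proj z x).choose_spec.2 a ha

/-- The point of the next copy of `K` which is closest to a given point. -/
def step (z : ι × Bool) (x : K) : K := S.letterPE z (S.proj z x)

/-- The point of the last copy of `K` along a path of copies which is closest to a given point of
the first copy. -/
def gate (L : List (ι × Bool)) (x : K) : K := L.foldl (fun y z => S.step z y) x

/-- The distance from a point of the first copy of `K` to the last copy along a path of copies. -/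
def offset : List (ι × Bool) → K → ℝ
  | [], _ => 0
  | z :: L, x => dist x (S.proj z x) + offset L (S.step z x)

theorem gate_append (L : List (ι × Bool)) (z : ι × Bool) (x : K) :
    S.gate (L ++ [z]) x = S.step z (S.gate L x) := by
  simp [gate]

theorem offset_append (L : List (ι × Bool)) (z : ι × Bool) (x : K) :
    S.offset (L ++ [z]) x =
      S.offset L x + dist (S.gate L x) (S.proj z (S.gate L x)) := by
  induction L generalizing x with
  | nil => simp [offset, gate]
  | cons b L ih =>
    simp only [List.cons_append, offset, ih, add_assoc]
    rfl

/-- The distance between a point of the first copy of `K` and a point of the last copy along a path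
of copies. -/
def wordDist (L : List (ι × Bool)) (x y : K) : ℝ := S.offset L x + dist (S.gate L x) y

theorem wordDist_nil (x y : K) : S.wordDist [] x y = dist x y := by
  simp [wordDist, offset, gate]

theorem wordDist_cons (z : ι × Bool) (L : List (ι × Bool)) (x y : K) :
    S.wordDist (z :: L) x y = dist x (S.proj z x) + S.wordDist L (S.step z x) y := by
  simp [wordDist, offset, gate, add_assoc]

theorem wordDist_append (L : List (ι × Bool)) (z : ι × Bool) (x : K) {y : K}
    (hy : y ∈ (S.letterPE z).source) :
    S.wordDist (L ++ [z]) x (S.letterPE z y) = S.wordDist L x y := by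
  rw [wordDist, gate_append, offset_append, step, S.dist_letterPE z (S.proj_mem _ _) hy,
    add_assoc, ← S.dist_proj z _ hy, wordDist]

/-- A function on the disjoint union of the copies of `K` which is `1`-Lipschitz on each copy and
compatible with the gluings is `1`-Lipschitz for `wordDist`. -/
theorem abs_sub_le_wordDist {f : FreeGroup ι → K → ℝ}
    (hlip : ∀ u x y, |f u x - f u y| ≤ dist x y)
    (hglue : ∀ u z, ∀ x ∈ (S.letterPE z).source,
      f (u * FreeGroup.mk [z]) (S.letterPE z x) = f u x)
    (L : List (ι × Bool)) (u : FreeGroup ι) (x y : K) :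
    |f u x - f (u * FreeGroup.mk L) y| ≤ S.wordDist L x y := by
  induction L generalizing u x with
  | nil => simpa [wordDist_nil, ← FreeGroup.one_eq_mk] using hlip u x y
  | cons z L ih =>
    have h₁ := ih (u * FreeGroup.mk [z]) (S.step z x)
    rw [step, hglue u z _ (S.proj_mem z x), mul_assoc, FreeGroup.mul_mk,
      List.singleton_append] at h₁
    have h₂ := hlip u x (S.proj z x)
    have h₃ := abs_sub_le (f u x) (f u (S.proj z x)) (f (u * FreeGroup.mk (z :: L)) y)
    rw [wordDist_cons, step]
    linarith

variable [DecidableEq ι]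

theorem wordDist_mul_letter (w : FreeGroup ι) (z : ι × Bool) (x : K) {y : K}
    (hy : y ∈ (S.letterPE z).source) :
    S.wordDist (w * FreeGroup.mk [z]).toWord x (S.letterPE z y) = S.wordDist w.toWord x y := by
  rcases toWord_mul_letter w z with h | h
  · rw [h, S.wordDist_append _ _ _ hy]
  · have hy' : S.letterPE z y ∈ (S.letterPE (invLetter z)).source := by
      rw [letterPE_invLetter]; exact (S.letterPE z).map_source hy
    have := S.wordDist_append (w * FreeGroup.mk [z]).toWord (invLetter z) x hy'
    rw [← h, letterPE_invLetter, (S.letterPE z).left_inv hy] at this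
    exact this.symm

/-- The distance between two points of the disjoint union of the copies of `K`. -/
def preDist (u : FreeGroup ι) (x : K) (v : FreeGroup ι) (y : K) : ℝ :=
  S.wordDist (u⁻¹ * v).toWord x y

theorem preDist_same (u : FreeGroup ι) (x y : K) : S.preDist u x u y = dist x y := by
  simp [preDist, wordDist_nil]

theorem preDist_glue (u : FreeGroup ι) (x : K) (v : FreeGroup ι) (z : ι × Bool) {y : K}
    (hy : y ∈ (S.letterPE z).source) :
    S.preDist u x (v * FreeGroup.mk [z]) (S.letterPE z y) = S.preDist u x v y := by
  rw [preDist, ← mul_assoc, S.wordDist_mul_letter _ _ _ hy, preDist]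

theorem abs_sub_le_preDist {f : FreeGroup ι → K → ℝ}
    (hlip : ∀ u x y, |f u x - f u y| ≤ dist x y)
    (hglue : ∀ u z, ∀ x ∈ (S.letterPE z).source,
      f (u * FreeGroup.mk [z]) (S.letterPE z x) = f u x) (u : FreeGroup ι) (x : K)
    (v : FreeGroup ι) (y : K) : |f u x - f v y| ≤ S.preDist u x v y := by
  have h := S.abs_sub_le_wordDist hlip hglue (u⁻¹ * v).toWord u x y
  rwa [FreeGroup.mk_toWord, mul_inv_cancel_left] at h

theorem abs_preDist_sub_le (u : FreeGroup ι) (x : K) (v : FreeGroup ι) (y : K)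
    (w : FreeGroup ι) (t : K) :
    |S.preDist u x v y - S.preDist u x w t| ≤ S.preDist v y w t := by
  refine S.abs_sub_le_preDist (f := S.preDist u x) (fun w y y' => ?_)
    (fun w z y hy => S.preDist_glue u x w z hy) v y w t
  simp only [preDist, wordDist, add_sub_add_left_eq_sub]
  rw [dist_comm _ y, dist_comm _ y']
  exact abs_dist_sub_le y y' _

theorem preDist_comm (u : FreeGroup ι) (x : K) (v : FreeGroup ι) (y : K) :
    S.preDist u x v y = S.preDist v y u x := by
  have key : ∀ u x v y, S.preDist u x v y ≤ S.preDist v y u x := by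
    intro u x v y
    have h := S.abs_preDist_sub_le u x v y u x
    rw [S.preDist_same u, dist_self, sub_zero] at h
    exact (le_abs_self _).trans h
  exact le_antisymm (key _ _ _ _) (key _ _ _ _)

end Gate

/-- The disjoint union of copies of `K`, indexed by the free group. -/
structure Copies {K ι : Type} [MetricSpace K] (S : SystemOfIsometries K ι) where
  vertex : FreeGroup ι
  point : K

section Tree

variable {K : Type} [MetricSpace K] [CompactSpace K] [IsRTree K] {ι : Type} [DecidableEq ι]
  (S : SystemOfIsometries K ι)

instance : PseudoMetricSpace S.Copies where
  dist p q := S.preDist p.vertex p.point q.vertex q.point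
  dist_self p := by
    rw [preDist_same, dist_self]
  dist_comm p q := S.preDist_comm _ _ _ _
  dist_triangle p q r := by
    have h := S.abs_preDist_sub_le p.vertex p.point r.vertex r.point q.vertex q.point
    rw [S.preDist_comm r.vertex] at h
    linarith [le_abs_self (S.preDist p.vertex p.point r.vertex r.point -
      S.preDist p.vertex p.point q.vertex q.point)]

theorem dist_copies (p q : S.Copies) :
    dist p q = S.preDist p.vertex p.point q.vertex q.point := rfl

theorem dist_copies_same (v : FreeGroup ι) (x y : K) :
    dist (⟨v, x⟩ : S.Copies) ⟨v, y⟩ = dist x y := S.preDist_same v x y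

theorem dist_copies_glue (p : S.Copies) (v : FreeGroup ι) (z : ι × Bool) {y : K}
    (hy : y ∈ (S.letterPE z).source) :
    dist p ⟨v * FreeGroup.mk [z], S.letterPE z y⟩ = dist p ⟨v, y⟩ :=
  S.preDist_glue _ _ v z hy

theorem exists_gate_copies (p : S.Copies) (v : FreeGroup ι) :
    ∃ g : K, ∀ y : K, dist p ⟨v, y⟩ = dist p ⟨v, g⟩ + dist g y := by
  refine ⟨S.gate (p.vertex⁻¹ * v).toWord p.point, fun y => ?_⟩
  simp [dist_copies, preDist, wordDist]

/-- A point of a copy of `K` which is not further away from the base copy than the copy `v` sees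
this copy through its edge towards the base copy. -/
theorem dist_copies_of_length_le {p : S.Copies} {v v' : FreeGroup ι} {z : ι × Bool}
    (hv : v.toWord = v'.toWord ++ [z]) (hlen : p.vertex.toWord.length ≤ v.toWord.length)
    (hne : p.vertex ≠ v) (y : K) :
    dist p ⟨v, y⟩ = dist p ⟨v, S.proj (invLetter z) y⟩ +
      dist (S.proj (invLetter z) y) y := by
  have hv' : v = v' * FreeGroup.mk [z] := by
    rw [← FreeGroup.mk_toWord (x := v), hv, ← FreeGroup.mul_mk, FreeGroup.mk_toWord]
  have h : (p.vertex⁻¹ * v).toWord = (p.vertex⁻¹ * v').toWord ++ [z] := by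
    rcases toWord_mul_letter (p.vertex⁻¹ * v') z with h | h
    · rwa [mul_assoc, ← hv'] at h
    · rw [mul_assoc, ← hv'] at h
      exact absurd (eq_of_toWord_mul_letter hv hlen h) hne
  have hg : S.gate (p.vertex⁻¹ * v).toWord p.point ∈ (S.letterPE (invLetter z)).source := by
    rw [h, gate_append, letterPE_invLetter]
    exact (S.letterPE z).map_source (S.proj_mem _ _)
  simp only [dist_copies, preDist, wordDist]
  rw [dist_comm _ y, S.dist_proj (invLetter z) y hg, dist_comm _ y,
    dist_comm (S.gate _ _) (S.proj _ _)]
  ring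

theorem fourPoint_of_length_le (n : ℕ) : ∀ p q r s : S.Copies,
    p.vertex.toWord.length ≤ n → q.vertex.toWord.length ≤ n → r.vertex.toWord.length ≤ n →
    s.vertex.toWord.length ≤ n → FourPoint p q r s := by
  have same : ∀ v : FreeGroup ι, ∀ x y z w : S.Copies, x.vertex = v → y.vertex = v →
      z.vertex = v → w.vertex = v → FourPoint x y z w := by
    rintro v ⟨_, x⟩ ⟨_, y⟩ ⟨_, z⟩ ⟨_, w⟩ rfl rfl rfl rfl
    simpa only [FourPoint, dist_copies_same] using IsRTree.fourPoint x y z w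
  induction n with
  | zero =>
    intro p q r s hp hq hr hs
    have h1 : ∀ p : S.Copies, p.vertex.toWord.length ≤ 0 → p.vertex = 1 := fun p hp =>
      FreeGroup.toWord_eq_nil_iff.mp (List.length_eq_zero_iff.mp (Nat.le_zero.mp hp))
    exact same 1 p q r s (h1 p hp) (h1 q hq) (h1 r hr) (h1 s hs)
  | succ n ih =>
    have key : ∀ W : Finset (FreeGroup ι), (∀ v ∈ W, v.toWord.length ≤ n + 1) →
        let X : Set S.Copies := {p | p.vertex.toWord.length ≤ n ∨ p.vertex ∈ W}
        ∀ x ∈ X, ∀ y ∈ X, ∀ z ∈ X, ∀ w ∈ X, FourPoint x y z w := by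
      intro W
      induction W using Finset.induction with
      | empty =>
        intro _ X x hx y hy z hz w hw
        exact ih x y z w (by simpa [X] using hx) (by simpa [X] using hy) (by simpa [X] using hz)
          (by simpa [X] using hw)
      | insert v W hvW ihW =>
        intro hW X
        replace ihW := ihW fun u hu => hW u (Finset.mem_insert_of_mem hu)
        rcases Nat.lt_or_ge n v.toWord.length with hlt | hle
        · obtain ⟨L, z, hL⟩ : ∃ L z, v.toWord = L ++ [z] := by
            rcases List.eq_nil_or_concat v.toWord with h | ⟨L, z, h⟩
            · simp [h] at hlt
            · exact ⟨L, z, by rw [h, List.concat_eq_append]⟩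
          have hvlen := hW v (Finset.mem_insert_self v W)
          have hv' : (FreeGroup.mk L).toWord = L := by
            refine toWord_eq_of_mk ((FreeGroup.isReduced_toWord (x := v)).infix ?_) rfl
            rw [hL]
            exact (List.prefix_append _ _).isInfix
          have hvmul : v * FreeGroup.mk [invLetter z] = FreeGroup.mk L := by
            rw [mk_singleton_invLetter, mul_inv_eq_iff_eq_mul, FreeGroup.mul_mk, ← hL,
              FreeGroup.mk_toWord]
          have hLn : L.length ≤ n := by
            rw [hL, List.length_append, List.length_singleton] at hvlen
            omega
          have hunion := fourPoint_union (Y := {p : S.Copies | p.vertex = v}) ihW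
            (fun x hx y hy z hz w hw => same v x y z w hx hy hz hw) ?_ ?_
          · intro x hx y hy z hz w hw
            have hsub : ∀ x ∈ X, x ∈ {p : S.Copies | p.vertex.toWord.length ≤ n ∨ p.vertex ∈ W} ∪
                {p | p.vertex = v} := by
              rintro x (hx | hx)
              · exact Or.inl (Or.inl hx)
              · rcases Finset.mem_insert.mp hx with hx | hx
                · exact Or.inr hx
                · exact Or.inl (Or.inr hx)
            exact hunion x (hsub x hx) y (hsub y hy) z (hsub z hz) w (hsub w hw)
          · rintro ⟨u, y⟩ hu
            obtain rfl : u = v := hu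
            have hzero : ∀ x : S.Copies, dist x ⟨FreeGroup.mk L,
                S.letterPE (invLetter z) (S.proj (invLetter z) y)⟩ =
                dist x ⟨u, S.proj (invLetter z) y⟩ := fun x => by
              rw [← hvmul, S.dist_copies_glue _ _ _ (S.proj_mem _ _)]
            refine ⟨⟨FreeGroup.mk L, S.letterPE (invLetter z) (S.proj (invLetter z) y)⟩,
              Or.inl (by simpa only [hv'] using hLn),
              ⟨⟨u, S.proj (invLetter z) y⟩, rfl, by rw [dist_comm, hzero, dist_self]⟩, ?_⟩
            intro x hx
            have hxv : x.vertex.toWord.length ≤ n + 1 ∧ x.vertex ≠ u := by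
              rcases hx with hx | hx
              · exact ⟨by omega, fun h => by rw [h] at hx; omega⟩
              · exact ⟨hW _ (Finset.mem_insert_of_mem hx), fun h => hvW (h ▸ hx)⟩
            rw [dist_comm _ x, S.dist_copies_of_length_le (hL.trans (by rw [hv'])) (by omega)
              hxv.2 y, hzero, dist_comm _ x, hzero, dist_copies_same, dist_comm y, add_comm]
          · intro p _
            obtain ⟨g, hg⟩ := S.exists_gate_copies p v
            refine ⟨⟨v, g⟩, rfl, ?_⟩
            rintro ⟨_, y⟩ rfl
            rw [dist_copies_same]
            exact hg y
        · intro x hx y hy z hz w hw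
          have hsub : ∀ x ∈ X, x.vertex.toWord.length ≤ n ∨ x.vertex ∈ W := by
            rintro x (hx | hx)
            · exact Or.inl hx
            · rcases Finset.mem_insert.mp hx with hx | hx
              · exact Or.inl (hx ▸ hle)
              · exact Or.inr hx
          exact ihW x (hsub x hx) y (hsub y hy) z (hsub z hz) w (hsub w hw)
    intro p q r s hp hq hr hs
    refine key {p.vertex, q.vertex, r.vertex, s.vertex} ?_ p ?_ q ?_ r ?_ s ?_ <;>
      simp [hp, hq, hr, hs]

theorem fourPoint_copies (p q r s : S.Copies) : FourPoint p q r s :=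
  S.fourPoint_of_length_le (p.vertex.toWord.length + q.vertex.toWord.length +
    r.vertex.toWord.length + s.vertex.toWord.length) p q r s (by omega) (by omega) (by omega)
    (by omega)

/-- The metric space obtained by gluing the copies of `K`. -/
abbrev Glued : Type := SeparationQuotient S.Copies

/-- The image of a point of a copy of `K` in the glued space. -/
def toGlued (v : FreeGroup ι) (x : K) : S.Glued := SeparationQuotient.mk ⟨v, x⟩

theorem toGlued_surjective (p : S.Glued) : ∃ v x, p = S.toGlued v x := by
  obtain ⟨⟨v, x⟩, rfl⟩ := SeparationQuotient.surjective_mk p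
  exact ⟨v, x, rfl⟩

theorem dist_toGlued (v w : FreeGroup ι) (x y : K) :
    dist (S.toGlued v x) (S.toGlued w y) = S.preDist v x w y := rfl

theorem isometry_toGlued (v : FreeGroup ι) : Isometry (S.toGlued v) :=
  Isometry.of_dist_eq fun x y => by rw [dist_toGlued, preDist_same]

theorem toGlued_glue (v : FreeGroup ι) (z : ι × Bool) {x : K} (hx : x ∈ (S.letterPE z).source) :
    S.toGlued (v * FreeGroup.mk [z]) (S.letterPE z x) = S.toGlued v x := by
  rw [← dist_eq_zero, dist_comm, dist_toGlued, S.preDist_glue _ _ _ _ hx, preDist_same, dist_self]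

theorem four_point_glued (p q r s : S.Glued) :
    dist p q + dist r s ≤ max (dist p r + dist q s) (dist p s + dist q r) := by
  obtain ⟨p, rfl⟩ := SeparationQuotient.surjective_mk p
  obtain ⟨q, rfl⟩ := SeparationQuotient.surjective_mk q
  obtain ⟨r, rfl⟩ := SeparationQuotient.surjective_mk r
  obtain ⟨s, rfl⟩ := SeparationQuotient.surjective_mk s
  exact (S.fourPoint_copies p q r s).1

instance : MulAction (FreeGroup ι) S.Glued where
  smul g := SeparationQuotient.lift (fun p => S.toGlued (g * p.vertex) p.point) fun p q h => by
    rw [← dist_eq_zero, dist_toGlued]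
    have := Metric.inseparable_iff.mp h
    rw [dist_copies, preDist] at this
    rw [preDist, ← this]
    group
  one_smul p := by
    obtain ⟨v, x, rfl⟩ := S.toGlued_surjective p
    change S.toGlued (1 * v) x = _
    rw [one_mul]
  mul_smul g h p := by
    obtain ⟨v, x, rfl⟩ := S.toGlued_surjective p
    change S.toGlued (g * h * v) x = S.toGlued (g * (h * v)) x
    rw [mul_assoc]

theorem smul_toGlued (g v : FreeGroup ι) (x : K) : g • S.toGlued v x = S.toGlued (g * v) x := rfl

theorem isometry_smul_glued (g : FreeGroup ι) : Isometry fun p : S.Glued => g • p :=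
  Isometry.of_dist_eq fun p q => by
    obtain ⟨v, x, rfl⟩ := S.toGlued_surjective p
    obtain ⟨w, y, rfl⟩ := S.toGlued_surjective q
    simp only [smul_toGlued, dist_toGlued, preDist]
    group

/-- A property of pairs of points of the glued space which holds for points in the same copy of `K`
and is preserved by concatenation of segments holds for all pairs. -/
theorem glued_induction {motive : S.Glued → S.Glued → Prop}
    (same : ∀ v x y, motive (S.toGlued v x) (S.toGlued v y))
    (concat : ∀ p m q, m ∈ seg p q → motive p m → motive m q → motive p q) (p q : S.Glued) :
    motive p q := by
  have key : ∀ (L : List (ι × Bool)), FreeGroup.IsReduced L → ∀ v x y,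
      motive (S.toGlued v x) (S.toGlued (v * FreeGroup.mk L) y) := by
    intro L
    induction L with
    | nil =>
      intro _ v x y
      rw [← FreeGroup.one_eq_mk, mul_one]
      exact same v x y
    | cons z L ih =>
      intro hL v x y
      have hL' : FreeGroup.IsReduced L := hL.infix (List.suffix_cons z L).isInfix
      have hm : S.toGlued (v * FreeGroup.mk [z]) (S.step z x) = S.toGlued v (S.proj z x) :=
        S.toGlued_glue v z (S.proj_mem z x)
      have hv : v * FreeGroup.mk (z :: L) = v * FreeGroup.mk [z] * FreeGroup.mk L := by
        rw [mul_assoc, FreeGroup.mul_mk, List.singleton_append]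
      refine concat _ (S.toGlued v (S.proj z x)) _ ?_ (same v x _) ?_
      · change dist _ _ + dist _ _ = dist _ _
        have h₁ := toWord_eq_of_mk hL (w := v⁻¹ * (v * FreeGroup.mk (z :: L))) (by group)
        have h₂ := toWord_eq_of_mk hL'
          (w := (v * FreeGroup.mk [z])⁻¹ * (v * FreeGroup.mk [z] * FreeGroup.mk L)) (by group)
        rw [(S.isometry_toGlued v).dist_eq, ← hm, dist_toGlued, dist_toGlued, preDist, preDist,
          h₁, hv, h₂, wordDist_cons]
      · rw [← hm, hv]
        exact ih hL' _ _ _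
  obtain ⟨v, x, rfl⟩ := S.toGlued_surjective p
  obtain ⟨w, y, rfl⟩ := S.toGlued_surjective q
  have h := key (v⁻¹ * w).toWord FreeGroup.isReduced_toWord v x y
  rwa [FreeGroup.mk_toWord, mul_inv_cancel_left] at h

instance : IsRTree S.Glued where
  geodesic := S.glued_induction (motive := GeodesicallyJoined)
    (fun v x y => GeodesicallyJoined.map (S.isometry_toGlued v) (IsRTree.geodesic x y))
    (fun _ _ _ hm h h' => h.concat h' hm)
  four_point := S.four_point_glued

theorem seg_cover_glued (p q : S.Glued) : ∃ F : Finset (FreeGroup ι),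
    seg p q ⊆ ⋃ w ∈ F, w • range (S.toGlued 1) := by
  refine S.glued_induction (motive := fun p q => ∃ F : Finset (FreeGroup ι),
    seg p q ⊆ ⋃ w ∈ F, w • range (S.toGlued 1)) (fun v x y => ⟨{v}, ?_⟩) ?_ p q
  · intro z hz
    obtain ⟨t, rfl⟩ := isSubtree_range (S.isometry_toGlued v) _ ⟨x, rfl⟩ _ ⟨y, rfl⟩ hz
    simp only [Finset.mem_singleton, iUnion_iUnion_eq_left]
    exact ⟨S.toGlued 1 t, ⟨t, rfl⟩, by simp [smul_toGlued]⟩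
  · rintro p m q hm ⟨F, hF⟩ ⟨F', hF'⟩
    refine ⟨F ∪ F', fun z hz => ?_⟩
    rw [Finset.set_biUnion_union]
    exact (seg_subset_union S.four_point_glued hm hz).imp (@hF z) (@hF' z)

theorem compat_glued (i : ι) {x : K} (hx : x ∈ (S.pe i).source) :
    (FreeGroup.of i)⁻¹ • S.toGlued 1 x = S.toGlued 1 (S.pe i x) := by
  have h := S.toGlued_glue (FreeGroup.of i)⁻¹ (i, true) (x := x) hx
  rw [smul_toGlued, mul_one, ← h]
  change S.toGlued ((FreeGroup.of i)⁻¹ * FreeGroup.of i) _ = _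
  rw [inv_mul_cancel]
  rfl

/-- A compatible isometry of `K` into a metric space with an isometric action extends to the glued
space. -/
theorem exists_extension_glued {T : Type*} [MetricSpace T] [MulAction (FreeGroup ι) T]
    (hiso : ∀ g : FreeGroup ι, Isometry fun x : T => g • x) {e : K → T} (he : Isometry e)
    (hcompat : ∀ i : ι, ∀ x ∈ (S.pe i).source, (FreeGroup.of i)⁻¹ • e x = e (S.pe i x)) :
    ∃ f : S.Glued → T, Continuous f ∧ ∀ v x, f (S.toGlued v x) = v • e x := by
  have hglue : ∀ (u : FreeGroup ι) (z : ι × Bool), ∀ x ∈ (S.letterPE z).source,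
      (u * FreeGroup.mk [z]) • e (S.letterPE z x) = u • e x := by
    rintro u ⟨i, _ | _⟩ x hx
    · have h := hcompat i _ ((S.pe i).map_target hx)
      rw [(S.pe i).right_inv hx, inv_smul_eq_iff] at h
      change (u * (FreeGroup.of i)⁻¹) • e ((S.pe i).symm x) = _
      rw [mul_smul, h, inv_smul_smul]
    · change (u * FreeGroup.of i) • e (S.pe i x) = _
      rw [mul_smul, ← hcompat i x hx, smul_inv_smul]
  have hlip : ∀ p q : S.Copies,
      dist (p.vertex • e p.point) (q.vertex • e q.point) ≤ dist p q := by
    intro p q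
    have h := S.abs_sub_le_preDist (f := fun u x => dist (p.vertex • e p.point) (u • e x))
      (fun u x y => ?_) (fun u z x hx => by rw [hglue u z x hx]) p.vertex p.point q.vertex q.point
    · rw [dist_self, zero_sub, abs_neg, abs_of_nonneg dist_nonneg] at h
      exact h
    · rw [dist_comm _ (u • e x), dist_comm _ (u • e y)]
      refine (abs_dist_sub_le _ _ _).trans ?_
      rw [(hiso u).dist_eq, he.dist_eq]
  refine ⟨SeparationQuotient.lift (fun p => p.vertex • e p.point) fun p q h => ?_, ?_,
    fun v x => rfl⟩
  · exact dist_le_zero.mp ((hlip p q).trans_eq (Metric.inseparable_iff.mp h))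
  · exact SeparationQuotient.continuous_lift
      (LipschitzWith.of_dist_le_mul (K := 1) (by simpa using hlip)).continuous

end Tree

end SystemOfIsometries

section Translates

variable {K T ι : Type} [MetricSpace K] [MetricSpace T] [MulAction (FreeGroup ι) T] {e : K → T}

theorem isCompact_smul_range [CompactSpace K]
    (hiso : ∀ g : FreeGroup ι, Isometry fun x : T => g • x)
    (he : Isometry e) (w : FreeGroup ι) : IsCompact (w • range e) :=
  (isCompact_range he.continuous).image (hiso w).continuous

theorem isSubtree_smul_range [IsRTree K] [IsRTree T]
    (hiso : ∀ g : FreeGroup ι, Isometry fun x : T => g • x)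
    (he : Isometry e) (w : FreeGroup ι) : IsSubtree (w • range e) := by
  have h := isSubtree_range ((hiso w).comp he)
  rwa [range_comp] at h

theorem dist_map_of_mem_smul_range {T' : Type*} [MetricSpace T'] [MulAction (FreeGroup ι) T']
    (hiso : ∀ g : FreeGroup ι, Isometry fun x : T => g • x)
    (hiso' : ∀ g : FreeGroup ι, Isometry fun x : T' => g • x) {e' : K → T'} (he : Isometry e)
    (he' : Isometry e') {f : T → T'}
    (hf : ∀ (w : FreeGroup ι) x, f (w • e x) = w • e' x) (w : FreeGroup ι) :
    ∀ x ∈ w • range e, ∀ y ∈ w • range e, dist (f x) (f y) = dist x y := by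
  rintro _ ⟨_, ⟨x, rfl⟩, rfl⟩ _ ⟨_, ⟨y, rfl⟩, rfl⟩
  simp only [hf]
  rw [(hiso' w).dist_eq, (hiso w).dist_eq, he.dist_eq, he'.dist_eq]

end Translates

namespace AssocTree

variable {K : Type} [MetricSpace K] [CompactSpace K] {ι : Type} [DecidableEq ι]

/-- The associated tree obtained by gluing copies of `K`. -/
def ofGlued [IsRTree K] (S : SystemOfIsometries K ι) : AssocTree S where
  carrier := S.Glued
  tree := inferInstance
  act_isom := S.isometry_smul_glued
  emb := S.toGlued 1
  emb_isom := S.isometry_toGlued 1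
  emb_subtree := isSubtree_range (S.isometry_toGlued 1)
  compat i _ hx := S.compat_glued i hx
  orbit_meets p := by
    obtain ⟨v, x, rfl⟩ := S.toGlued_surjective p
    exact ⟨v, x, by rw [S.smul_toGlued, mul_one]⟩
  seg_cover := S.seg_cover_glued
  universal T' _ _ hiso e' he' hcompat := by
    obtain ⟨f, hfc, hf⟩ := S.exists_extension_glued hiso he' hcompat
    have hf' : ∀ w x, f (w • S.toGlued 1 x) = w • e' x := fun w x => by
      rw [S.smul_toGlued, mul_one, hf]
    refine ⟨f, ⟨?_, ?_, fun x => by rw [hf, one_smul]⟩, ?_⟩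
    · refine isTreeMorphism_of_cover hfc
        (isCompact_smul_range S.isometry_smul_glued (S.isometry_toGlued 1))
        (isSubtree_smul_range S.isometry_smul_glued (S.isometry_toGlued 1))
        (fun w x hx y hy hxy => ?_) S.seg_cover_glued
      rw [← dist_eq_zero, ← dist_map_of_mem_smul_range S.isometry_smul_glued hiso
        (S.isometry_toGlued 1) he' hf' w x hx y hy, hxy, dist_self]
    · intro g p
      obtain ⟨v, x, rfl⟩ := S.toGlued_surjective p
      rw [S.smul_toGlued, hf, hf, mul_smul]
    · rintro f' ⟨-, heq, hemb⟩
      funext p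
      obtain ⟨v, x, rfl⟩ := S.toGlued_surjective p
      rw [hf, ← hemb, ← heq, S.smul_toGlued, mul_one]

/-- The comparison map between two associated trees does not increase distances. -/
theorem exists_dist_le {S : SystemOfIsometries K ι} (A B : AssocTree S) :
    ∃ f : A.carrier → B.carrier,
    (∀ (g : FreeGroup ι) (p : A.carrier), f (g • p) = g • f p) ∧
    (∀ x : K, f (A.emb x) = B.emb x) ∧ ∀ p q, dist (f p) (f q) ≤ dist p q := by
  obtain ⟨f, ⟨-, heq, hemb⟩, -⟩ := A.universal B.carrier B.act_isom B.emb B.emb_isom B.compat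
  refine ⟨f, heq, hemb, fun p q => ?_⟩
  have := A.tree
  obtain ⟨F, hF⟩ := A.seg_cover p q
  exact dist_le_of_seg_subset (isCompact_smul_range A.act_isom A.emb_isom)
    (dist_map_of_mem_smul_range A.act_isom B.act_isom A.emb_isom B.emb_isom
      fun w x => by rw [heq, hemb]) F p q hF

end AssocTree

/-- **Theorem 3.2.**  For every system of isometries `𝒦 = (K, 𝒜)` on a compact ℝ-tree `K`
there exists an ℝ-tree `T_𝒦` with an isometric action of `F(𝒜)` satisfying properties
(1)–(4) (bundled in `AssocTree`), and it is unique: any two such trees are related by an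
equivariant bijective isometry restricting to the identity on `K`. -/
theorem assoc_tree_exists_unique (K : Type) [MetricSpace K] [CompactSpace K] [IsRTree K]
    (ι : Type) [Fintype ι] [DecidableEq ι] (S : SystemOfIsometries K ι) :
    Nonempty (AssocTree S) ∧
    ∀ A B : AssocTree S, ∃ f : A.carrier → B.carrier,
      Function.Bijective f ∧ (∀ p q : A.carrier, dist (f p) (f q) = dist p q) ∧
      (∀ (g : FreeGroup ι) (p : A.carrier), f (g • p) = g • f p) ∧
      ∀ x : K, f (A.emb x) = B.emb x := by
  refine ⟨⟨AssocTree.ofGlued S⟩, fun A B => ?_⟩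
  obtain ⟨f, feq, femb, fle⟩ := A.exists_dist_le B
  obtain ⟨g, geq, gemb, gle⟩ := B.exists_dist_le A
  have hgf : ∀ p, g (f p) = p := fun p => by
    obtain ⟨w, x, rfl⟩ := A.orbit_meets p
    rw [feq, femb, geq, gemb]
  have hfg : ∀ p, f (g p) = p := fun p => by
    obtain ⟨w, x, rfl⟩ := B.orbit_meets p
    rw [geq, gemb, feq, femb]
  refine ⟨f, ⟨Function.LeftInverse.injective hgf, Function.RightInverse.surjective hfg⟩,
    fun p q => le_antisymm (fle p q) ?_, feq, femb⟩
  simpa only [hgf] using gle (f p) (f q)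

end CHL
end
end
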